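/- Let p ≥ 2 and K > 0. There exists a constant C > 0, depending only on p and K, such that for every real Banach space B with modulus of uniform convexity η(ε) = K ε^p, every f ∈ ℓ^p(B), and every strictly increasing sequence (t_k)_{k∈ℕ} of positive integers, ∑_{x∈ℤ} ∑_k sup_{u, v ∈ [t_k, t_{k+1}]} ‖(A_u f)(x) − (A_v f)(x)‖_B^p ≤ C^p ‖f‖_{ℓ^p(B)}^p, where the supremum is over integers u, v with t_k ≤ u, v ≤ t_{k+1}. -/

import Mathlib

open Finset ENNReal NNReal

/-- The shift ergodic averages on `ℤ`: `(A_n f)(x) = (1/n) ∑_{i<n} f (x + i)`. -/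
noncomputable def shiftAvg {B : Type*} [AddCommGroup B] [Module ℝ B]
    (n : ℕ) (f : ℤ → B) (x : ℤ) : B :=
  (n : ℝ)⁻¹ • ∑ i ∈ Finset.range n, f (x + (i : ℤ))

section Convexity

/-- The Clarkson inequality for real numbers. -/
lemma clarkson_real {p a b : ℝ} (hp : 2 ≤ p) (hb : 0 ≤ b) (hab : b ≤ a) :
    ((a + b) / 2) ^ p + ((a - b) / 2) ^ p ≤ (a ^ p + b ^ p) / 2 := by
  have ha : 0 ≤ a := hb.trans hab
  have hp2 : 1 ≤ p / 2 := by linarith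
  have key : ∀ z : ℝ, 0 ≤ z → z ^ p = (z ^ 2) ^ (p / 2) := fun z hz => by
    rw [← Real.rpow_natCast, ← Real.rpow_mul hz]
    congr 1
    push_cast
    ring
  rw [key _ (by positivity : 0 ≤ (a + b) / 2), key _ (by linarith : 0 ≤ (a - b) / 2), key a ha,
    key b hb]
  calc (((a + b) / 2) ^ 2) ^ (p / 2) + (((a - b) / 2) ^ 2) ^ (p / 2)
      ≤ (((a + b) / 2) ^ 2 + ((a - b) / 2) ^ 2) ^ (p / 2) :=
        Real.add_rpow_le_rpow_add (by positivity) (by positivity) hp2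
    _ = (1 / 2 * a ^ 2 + 1 / 2 * b ^ 2) ^ (p / 2) := by congr 1; ring
    _ ≤ 1 / 2 * (a ^ 2) ^ (p / 2) + 1 / 2 * (b ^ 2) ^ (p / 2) :=
        (convexOn_rpow hp2).2 (sq_nonneg a) (sq_nonneg b) (by norm_num) (by norm_num) (by norm_num)
    _ = _ := by ring

/-- The constant in the two-point inequality of a space with modulus of convexity `K ε ^ p`. -/
noncomputable def convexityConst (p K : ℝ) : ℝ := min (K / 3) 1 * (1 / 4) ^ p

lemma convexityConst_pos {p K : ℝ} (hK : 0 < K) : 0 < convexityConst p K :=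
  mul_pos (lt_min (by positivity) one_pos) (by positivity)

/-- `B` has modulus of uniform convexity `K ε ^ p`. -/
def HasConvexityModulus (B : Type*) [NormedAddCommGroup B] [NormedSpace ℝ B] (p K : ℝ) : Prop :=
  ∀ ε ∈ Set.Ioc (0 : ℝ) 2, ∀ x y : B, ‖x‖ ≤ 1 → ‖y‖ ≤ 1 → ε ≤ ‖x - y‖ →
    ‖(1 / 2 : ℝ) • (x + y)‖ ≤ 1 - K * ε ^ p

variable {B : Type*} [NormedAddCommGroup B] [NormedSpace ℝ B] {p K : ℝ}

lemma HasConvexityModulus.two_point_unit (hB : HasConvexityModulus B p K) (hp : 2 ≤ p)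
    (hK : 0 < K) {x y : B} (hx : ‖x‖ = 1) (hy : ‖y‖ ≤ 1) :
    ‖(1 / 2 : ℝ) • (x + y)‖ ^ p + convexityConst p K * ‖x - y‖ ^ p
      ≤ (1 + ‖y‖ ^ p) / 2 := by
  set s := ‖y‖ with hs
  set ε := ‖x - y‖ with hε
  have hs0 : 0 ≤ s := norm_nonneg y
  have hε0 : 0 ≤ ε := norm_nonneg _
  have hεs : ε ≤ 1 + s := by simpa [hx] using norm_sub_le x y
  have hclark := clarkson_real hp hs0 hy
  rw [Real.one_rpow] at hclark
  rcases le_or_gt ε (2 * (1 - s)) with h | h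
  · -- the norms of `x` and `y` differ substantially
    have h1 : ‖(1 / 2 : ℝ) • (x + y)‖ ≤ (1 + s) / 2 := by
      rw [norm_smul]
      have := norm_add_le x y
      rw [hx] at this
      norm_num
      linarith
    have h2 : ‖(1 / 2 : ℝ) • (x + y)‖ ^ p ≤ ((1 + s) / 2) ^ p := by gcongr
    have h3 : convexityConst p K * ε ^ p ≤ ((1 - s) / 2) ^ p := by
      calc convexityConst p K * ε ^ p ≤ (1 * (1 / 4) ^ p) * ε ^ p := by
            unfold convexityConst; gcongr; exact min_le_right _ _
        _ = (ε / 4) ^ p := by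
            rw [one_mul, ← Real.mul_rpow (by norm_num) hε0]; congr 1; ring
        _ ≤ _ := Real.rpow_le_rpow (by positivity) (by linarith) (by linarith)
    linarith
  · have hs3 : 1 / 3 ≤ s := by linarith
    have hε1 : 0 < ε := by linarith
    have hspos : 0 < s := by linarith
    set y' : B := s⁻¹ • y with hy'
    have hyy : y = s • y' := by rw [hy', smul_smul, mul_inv_cancel₀ hspos.ne', one_smul]
    have hny' : ‖y'‖ = 1 := by
      rw [hy', norm_smul, norm_inv, Real.norm_of_nonneg hs0, ← hs, inv_mul_cancel₀ hspos.ne']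
    have hdist : ε / 2 ≤ ‖x - y'‖ := by
      have h1 : ‖x - y‖ ≤ ‖x - y'‖ + ‖y' - y‖ := norm_sub_le_norm_sub_add_norm_sub _ _ _
      have h2 : ‖y' - y‖ = 1 - s := by
        have : y' - y = (1 - s) • y' := by rw [sub_smul, one_smul, ← hyy]
        rw [this, norm_smul, hny', mul_one, Real.norm_of_nonneg (by linarith)]
      linarith
    have hmod := hB (ε / 2) ⟨by linarith, by linarith⟩ x y' hx.le hny'.le hdist
    set z := s * (K * (ε / 2) ^ p) with hz
    set m := (1 + s) / 2 with hm
    have hz0 : 0 ≤ z := by positivity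
    have hle : ‖(1 / 2 : ℝ) • (x + y)‖ ≤ m - z := by
      have : (1 / 2 : ℝ) • (x + y) = s • ((1 / 2 : ℝ) • (x + y')) + ((1 - s) / 2) • x := by
        rw [hyy]; module
      rw [this]
      refine (norm_add_le _ _).trans ?_
      rw [norm_smul s, norm_smul _ x, hx, Real.norm_of_nonneg hs0,
        Real.norm_of_nonneg (by linarith : 0 ≤ (1 - s) / 2)]
      have := mul_le_mul_of_nonneg_left hmod hs0
      rw [hz, hm]
      linarith
    have hzm : z ≤ m := by linarith [norm_nonneg ((1 / 2 : ℝ) • (x + y))]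
    have hm0 : 1 / 2 ≤ m := by rw [hm]; linarith
    have hmpos : 0 < m := by linarith
    have hpow : (m - z) ^ p ≤ m ^ p - m ^ p * (z / m) := by
      have h1 : m - z = m * (1 - z / m) := by field_simp
      have h2 : 0 ≤ 1 - z / m := by rw [sub_nonneg, div_le_one hmpos]; exact hzm
      rw [h1, Real.mul_rpow hmpos.le h2]
      have h3 : (1 - z / m) ^ p ≤ 1 - z / m := by
        have : (1 - z / m) ^ p ≤ (1 - z / m) ^ (1 : ℝ) :=
          Real.rpow_le_rpow_of_exponent_ge' h2 (by linarith [div_nonneg hz0 hmpos.le])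
            (by norm_num) (by linarith)
        simpa using this
      nlinarith [Real.rpow_nonneg hmpos.le p]
    have hgain : convexityConst p K * ε ^ p ≤ m ^ p * (z / m) := by
      have h1 : (1 / 2 : ℝ) ^ p ≤ m ^ p := by gcongr
      have h2 : K / 3 * (ε / 2) ^ p ≤ z / m := by
        rw [le_div_iff₀ hmpos, hz]
        have hm1 : m ≤ 1 := by rw [hm]; linarith
        have : 0 ≤ K * (ε / 2) ^ p := by positivity
        nlinarith
      calc convexityConst p K * ε ^ p ≤ (K / 3 * (1 / 4) ^ p) * ε ^ p := by
            unfold convexityConst; gcongr; exact min_le_left _ _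
        _ = (1 / 2) ^ p * (K / 3 * (ε / 2) ^ p) := by
            have h4 : (1 / 4 : ℝ) ^ p * ε ^ p = (1 / 2) ^ p * (ε / 2) ^ p := by
              rw [← Real.mul_rpow (by norm_num) hε0,
                ← Real.mul_rpow (by norm_num) (by positivity)]
              congr 1; ring
            linear_combination K / 3 * h4
        _ ≤ _ := by gcongr
    have hpow' : ‖(1 / 2 : ℝ) • (x + y)‖ ^ p ≤ (m - z) ^ p := by gcongr
    have hnn : 0 ≤ ((1 - s) / 2) ^ p := Real.rpow_nonneg (by linarith) p
    linarith

/-- The two-point form of uniform convexity of power type. -/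
lemma HasConvexityModulus.two_point (hB : HasConvexityModulus B p K) (hp : 2 ≤ p)
    (hK : 0 < K) (x y : B) :
    ‖(1 / 2 : ℝ) • (x + y)‖ ^ p + convexityConst p K * ‖x - y‖ ^ p
      ≤ (‖x‖ ^ p + ‖y‖ ^ p) / 2 := by
  wlog hxy : ‖y‖ ≤ ‖x‖ generalizing x y
  · have := this y x (le_of_not_ge hxy)
    rwa [add_comm y x, norm_sub_rev y x, add_comm (‖y‖ ^ p)] at this
  have hp0 : p ≠ 0 := by linarith
  rcases eq_or_ne x 0 with rfl | hx
  · have : y = 0 := by simpa using hxy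
    simp [this, Real.zero_rpow hp0]
  have hr : 0 < ‖x‖ := norm_pos_iff.mpr hx
  have hinv : ∀ z : B, ‖‖x‖⁻¹ • z‖ = ‖z‖ / ‖x‖ := fun z => by
    rw [norm_smul, norm_inv, norm_norm, inv_mul_eq_div]
  have key := hB.two_point_unit hp hK (x := ‖x‖⁻¹ • x) (y := ‖x‖⁻¹ • y)
    (by rw [hinv, div_self hr.ne']) (by rw [hinv, div_le_one hr]; exact hxy)
  rw [← smul_add, ← smul_sub, smul_comm, hinv, hinv, hinv,
    Real.div_rpow (norm_nonneg _) hr.le, Real.div_rpow (norm_nonneg _) hr.le,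
    Real.div_rpow (norm_nonneg _) hr.le] at key
  have hrp : 0 < ‖x‖ ^ p := Real.rpow_pos_of_pos hr p
  have := mul_le_mul_of_nonneg_right key hrp.le
  field_simp at this
  linarith

/-- Averages over a finite family satisfy a Pisier type inequality in a uniformly convex space. -/
lemma HasConvexityModulus.average (hB : HasConvexityModulus B p K) (hp : 2 ≤ p)
    (hK : 0 < K) {J : ℕ} (hJ : 0 < J) (g : ℕ → B) :
    J * ‖(J : ℝ)⁻¹ • ∑ j ∈ range J, g j‖ ^ p
        + 2 * convexityConst p K *
          ∑ j ∈ range J, ‖g j - (J : ℝ)⁻¹ • ∑ j ∈ range J, g j‖ ^ p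
      ≤ ∑ j ∈ range J, ‖g j‖ ^ p := by
  set G := (J : ℝ)⁻¹ • ∑ j ∈ range J, g j with hG
  have hJ' : (0 : ℝ) < J := by exact_mod_cast hJ
  have hsum : ∑ j ∈ range J, g j = (J : ℝ) • G := by
    rw [hG, smul_smul, mul_inv_cancel₀ hJ'.ne', one_smul]
  have hjensen : J * ‖G‖ ^ p ≤ ∑ j ∈ range J, ‖(1 / 2 : ℝ) • (g j + G)‖ ^ p := by
    have h1 : (J : ℝ) * ‖G‖ ≤ ∑ j ∈ range J, ‖(1 / 2 : ℝ) • (g j + G)‖ := by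
      have : (J : ℝ) • G = ∑ j ∈ range J, (1 / 2 : ℝ) • (g j + G) := by
        rw [← Finset.smul_sum, Finset.sum_add_distrib, hsum, Finset.sum_const, card_range,
          ← Nat.cast_smul_eq_nsmul ℝ]
        module
      calc (J : ℝ) * ‖G‖ = ‖(J : ℝ) • G‖ := by rw [norm_smul (J : ℝ) G, Real.norm_of_nonneg hJ'.le]
        _ ≤ _ := by rw [this]; exact norm_sum_le _ _
    have h2 := Real.rpow_sum_le_const_mul_sum_rpow_of_nonneg (range J) (p := p)
      (f := fun j => ‖(1 / 2 : ℝ) • (g j + G)‖) (by linarith) (fun _ _ => norm_nonneg _)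
    have h3 : ((J : ℝ) * ‖G‖) ^ p ≤ (J : ℝ) ^ (p - 1) *
        ∑ j ∈ range J, ‖(1 / 2 : ℝ) • (g j + G)‖ ^ p := by
      refine le_trans (by gcongr) (h2.trans_eq ?_)
      rw [card_range]
    rw [Real.mul_rpow hJ'.le (norm_nonneg _)] at h3
    have h4 : (J : ℝ) ^ p = (J : ℝ) ^ (p - 1) * J := by
      rw [← Real.rpow_add_one hJ'.ne', sub_add_cancel]
    rw [h4, mul_assoc] at h3
    exact le_of_mul_le_mul_left h3 (Real.rpow_pos_of_pos hJ' _)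
  have htwo := Finset.sum_le_sum fun j (_ : j ∈ range J) => hB.two_point hp hK (g j) G
  rw [Finset.sum_add_distrib, ← Finset.mul_sum, ← Finset.sum_div, Finset.sum_add_distrib,
    Finset.sum_const, card_range, nsmul_eq_mul] at htwo
  linarith

end Convexity

section Maximal

/-- The maximal lemma of Garsia for a finite sequence. -/
lemma sum_le_sum_ite_exists_pos (L : ℕ) (g : ℕ → ℝ) (n : ℕ) (hn : n ≤ L) :
    ∑ i ∈ range n, g i ≤ ∑ j ∈ range L,
      open Classical in
      if ∃ n, j + n ≤ L ∧ 0 < ∑ i ∈ range n, g (j + i) then g j else 0 := by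
  classical
  induction L generalizing g n with
  | zero => simp [Nat.le_zero.mp hn]
  | succ L ih =>
    have hshift : ∀ j, (∃ n, j + 1 + n ≤ L + 1 ∧ 0 < ∑ i ∈ range n, g (j + 1 + i)) ↔
        ∃ n, j + n ≤ L ∧ 0 < ∑ i ∈ range n, g (j + i + 1) := fun j => by
      refine exists_congr fun n => and_congr (by omega) ?_
      simp only [add_right_comm]
    have ih' := ih (fun j => g (j + 1))
    rw [Finset.sum_range_succ']
    simp only [hshift, zero_add]
    set R := ∑ j ∈ range L,
      if ∃ n, j + n ≤ L ∧ 0 < ∑ i ∈ range n, g (j + i + 1) then g (j + 1) else 0 with hR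
    have hR0 : 0 ≤ R := by simpa using ih' 0 (Nat.zero_le _)
    by_cases hE : ∃ n, n ≤ L + 1 ∧ 0 < ∑ i ∈ range n, g i
    · rw [if_pos hE]
      have key : ∀ n, 0 < n → n ≤ L + 1 → ∑ i ∈ range n, g i ≤ R + g 0 := fun n hn0 hn => by
        obtain ⟨m, rfl⟩ := Nat.exists_eq_succ_of_ne_zero hn0.ne'
        rw [Finset.sum_range_succ']
        linarith [ih' m (by omega)]
      rcases Nat.eq_zero_or_pos n with rfl | hn0
      · obtain ⟨m, hm, hpos⟩ := hE
        have hm0 : 0 < m := Nat.pos_of_ne_zero fun h => by simp [h] at hpos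
        simpa using hpos.le.trans (key m hm0 hm)
      · exact key n hn0 hn
    · rw [if_neg hE, add_zero]
      push Not at hE
      exact (hE n hn).trans hR0

lemma integral_ite_lt_sub {a M Λ : ℝ} (hM : 0 ≤ M) (hΛ : M ≤ Λ) :
    IntervalIntegrable (fun l : ℝ => if l < M then a - l else 0) MeasureTheory.volume 0 Λ ∧
      ∫ l in (0 : ℝ)..Λ, (if l < M then a - l else 0) = a * M - M ^ 2 / 2 := by
  have hcont : Continuous fun l : ℝ => a - l := by fun_prop
  have hint1 : IntervalIntegrable (fun l : ℝ => if l < M then a - l else 0)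
      MeasureTheory.volume 0 M := by
    refine (hcont.intervalIntegrable 0 M).congr_uIoo fun l hl => ?_
    rw [Set.uIoo_of_le hM] at hl
    simp [hl.2]
  have hint2 : IntervalIntegrable (fun l : ℝ => if l < M then a - l else 0)
      MeasureTheory.volume M Λ := by
    refine (intervalIntegrable_const (c := (0 : ℝ))).congr_uIoo fun l hl => ?_
    rw [Set.uIoo_of_le hΛ] at hl
    simp [hl.1.le]
  refine ⟨hint1.trans hint2, ?_⟩
  rw [← intervalIntegral.integral_add_adjacent_intervals hint1 hint2]
  have h1 : ∫ l in (0 : ℝ)..M, (if l < M then a - l else 0) = ∫ l in (0 : ℝ)..M, (a - l) := by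
    refine intervalIntegral.integral_congr_uIoo fun l hl => ?_
    rw [Set.uIoo_of_le hM] at hl
    simp [hl.2]
  have h2 : ∫ l in M..Λ, (if l < M then a - l else 0) = ∫ l in M..Λ, (0 : ℝ) := by
    refine intervalIntegral.integral_congr fun l hl => ?_
    rw [Set.uIcc_of_le hΛ] at hl
    simp [hl.1]
  rw [h1, h2, intervalIntegral.integral_sub (by simp) (by simp)]
  simp
  ring

/-- The one-sided discrete Hardy–Littlewood maximal inequality in `ℓ²` on an interval. -/
lemma sum_sq_le_of_le_average {L : ℕ} {h a : ℕ → ℝ} (hh : ∀ j, 0 ≤ h j) (ha : ∀ j, 0 ≤ a j)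
    (hav : ∀ j < L, ∃ n, 0 < n ∧ j + n ≤ L ∧ n * a j ≤ ∑ i ∈ range n, h (j + i)) :
    ∑ j ∈ range L, a j ^ 2 ≤ 4 * ∑ j ∈ range L, h j ^ 2 := by
  classical
  let avg : ℕ → ℕ → ℝ := fun j n => (∑ i ∈ range n, h (j + i)) / n
  have hex : ∀ j, ∃ n, j < L → (0 < n ∧ j + n ≤ L ∧
      ∀ m, 0 < m → j + m ≤ L → avg j m ≤ avg j n) := fun j => by
    by_cases hj : j < L
    · obtain ⟨n, hn, hmax⟩ := Finset.exists_max_image (Finset.Icc 1 (L - j)) (avg j)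
        ⟨1, by simp; omega⟩
      rw [Finset.mem_Icc] at hn
      exact ⟨n, fun _ => ⟨by omega, by omega, fun m h1 h2 => hmax m (by simp; omega)⟩⟩
    · exact ⟨0, fun h => absurd h hj⟩
  choose N hN using hex
  let M : ℕ → ℝ := fun j => avg j (N j)
  have hM0 : ∀ j, 0 ≤ M j := fun j =>
    div_nonneg (Finset.sum_nonneg fun _ _ => hh _) (Nat.cast_nonneg _)
  have haM : ∀ j < L, a j ≤ M j := fun j hj => by
    obtain ⟨n, hn0, hn, hle⟩ := hav j hj
    refine le_trans ?_ ((hN j hj).2.2 n hn0 hn)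
    rw [le_div_iff₀ (by exact_mod_cast hn0), mul_comm]
    exact hle
  obtain ⟨Λ, hΛ⟩ : ∃ Λ, ∀ j < L, M j ≤ Λ :=
    ⟨∑ j ∈ range L, M j, fun j hj =>
      Finset.single_le_sum (f := M) (fun i _ => hM0 i) (Finset.mem_range.mpr hj)⟩
  rcases Nat.eq_zero_or_pos L with rfl | hL
  · simp
  have hΛ0 : 0 ≤ Λ := (hM0 0).trans (hΛ 0 hL)
  have hlevel : ∀ l, 0 ≤ l → 0 ≤ ∑ j ∈ range L, if l < M j then h j - l else 0 := by
    intro l _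
    have := sum_le_sum_ite_exists_pos L (fun j => h j - l) 0 (Nat.zero_le _)
    rw [Finset.sum_range_zero] at this
    refine this.trans_eq (Finset.sum_congr rfl fun j hj => ?_)
    rw [Finset.mem_range] at hj
    refine if_congr ?_ rfl rfl
    simp only [Finset.sum_sub_distrib, Finset.sum_const, card_range, nsmul_eq_mul, sub_pos]
    obtain ⟨hN0, hNL, hNmax⟩ := hN j hj
    constructor
    · rintro ⟨n, hn, hlt⟩
      have hn0 : 0 < n := Nat.pos_of_ne_zero fun h => by simp [h] at hlt
      refine lt_of_lt_of_le ?_ (hNmax n hn0 hn)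
      rw [lt_div_iff₀ (by exact_mod_cast hn0), mul_comm]
      exact hlt
    · intro hlt
      refine ⟨N j, hNL, ?_⟩
      have : l < (∑ i ∈ range (N j), h (j + i)) / N j := hlt
      rwa [lt_div_iff₀ (by exact_mod_cast hN0), mul_comm] at this
  have hint : 0 ≤ ∑ j ∈ range L, (h j * M j - M j ^ 2 / 2) := by
    have h1 : 0 ≤ ∫ l in (0 : ℝ)..Λ, ∑ j ∈ range L, (if l < M j then h j - l else 0) :=
      intervalIntegral.integral_nonneg hΛ0 fun l hl => hlevel l hl.1
    rw [intervalIntegral.integral_finsetSum fun j hj =>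
      (integral_ite_lt_sub (hM0 j) (hΛ j (Finset.mem_range.mp hj))).1] at h1
    refine h1.trans_eq (Finset.sum_congr rfl fun j hj => ?_)
    exact (integral_ite_lt_sub (hM0 j) (hΛ j (Finset.mem_range.mp hj))).2
  calc ∑ j ∈ range L, a j ^ 2 ≤ ∑ j ∈ range L, M j ^ 2 :=
        Finset.sum_le_sum fun j hj =>
          pow_le_pow_left₀ (ha j) (haM j (Finset.mem_range.mp hj)) 2
    _ ≤ ∑ j ∈ range L, (M j ^ 2 + 4 * (h j * M j - M j ^ 2 / 2) + (2 * h j - M j) ^ 2) := by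
        rw [Finset.sum_add_distrib, Finset.sum_add_distrib, ← Finset.mul_sum]
        have : 0 ≤ ∑ j ∈ range L, (2 * h j - M j) ^ 2 := Finset.sum_nonneg fun _ _ => sq_nonneg _
        linarith
    _ = 4 * ∑ j ∈ range L, h j ^ 2 := by
        rw [Finset.mul_sum]
        exact Finset.sum_congr rfl fun j _ => by ring

/-- The one-sided discrete Hardy–Littlewood maximal inequality in `ℓᵖ`, `p ≥ 2`. -/
lemma sum_rpow_le_of_le_average {p : ℝ} (hp : 2 ≤ p) {L : ℕ} {h a : ℕ → ℝ} (hh : ∀ j, 0 ≤ h j)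
    (ha : ∀ j, 0 ≤ a j)
    (hav : ∀ j < L, ∃ n, 0 < n ∧ j + n ≤ L ∧ n * a j ≤ ∑ i ∈ range n, h (j + i)) :
    ∑ j ∈ range L, a j ^ p ≤ 4 * ∑ j ∈ range L, h j ^ p := by
  have key : ∀ z : ℝ, 0 ≤ z → z ^ p = (z ^ (p / 2)) ^ 2 := fun z hz => by
    rw [← Real.rpow_natCast, ← Real.rpow_mul hz]
    congr 1
    push_cast
    ring
  simp only [key _ (ha _), key _ (hh _)]
  refine sum_sq_le_of_le_average (fun j => Real.rpow_nonneg (hh j) _)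
    (fun j => Real.rpow_nonneg (ha j) _) fun j hj => ?_
  obtain ⟨n, hn0, hn, hle⟩ := hav j hj
  refine ⟨n, hn0, hn, ?_⟩
  have hn' : (0 : ℝ) < n := by exact_mod_cast hn0
  have h1 := Real.rpow_sum_le_const_mul_sum_rpow_of_nonneg (range n) (p := p / 2)
    (f := fun i => h (j + i)) (by linarith) (fun _ _ => hh _)
  have h2 : ((n : ℝ) * a j) ^ (p / 2) ≤ (n : ℝ) ^ (p / 2 - 1) *
      ∑ i ∈ range n, h (j + i) ^ (p / 2) := by
    refine le_trans (Real.rpow_le_rpow (mul_nonneg hn'.le (ha j)) hle (by linarith))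
      (h1.trans_eq ?_)
    rw [card_range]
  have h3 : (n : ℝ) ^ (p / 2) = (n : ℝ) ^ (p / 2 - 1) * n := by
    rw [← Real.rpow_add_one hn'.ne', sub_add_cancel]
  rw [Real.mul_rpow hn'.le (ha j), h3, mul_assoc] at h2
  exact le_of_mul_le_mul_left h2 (Real.rpow_pos_of_pos hn' _)

end Maximal

section Averages

variable {B : Type*} [NormedAddCommGroup B] {p K : ℝ}

/-- The `p`-th power of the `ℓᵖ` norm. -/
noncomputable def lpSum (p : ℝ) (g : ℤ → B) : ℝ≥0∞ := ∑' x : ℤ, ‖g x‖ₑ ^ p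

lemma tsum_int_add (g : ℤ → ℝ≥0∞) (a : ℤ) : ∑' x : ℤ, g (x + a) = ∑' x : ℤ, g x :=
  (Equiv.addRight a).tsum_eq g

lemma lpSum_translate (p : ℝ) (g : ℤ → B) (a : ℤ) : lpSum p (fun x => g (x + a)) = lpSum p g :=
  tsum_int_add (fun x => ‖g x‖ₑ ^ p) a

lemma enorm_rpow_eq_ofReal (hp : 0 ≤ p) (x : B) : ‖x‖ₑ ^ p = ENNReal.ofReal (‖x‖ ^ p) := by
  rw [← ofReal_norm, ENNReal.ofReal_rpow_of_nonneg (norm_nonneg _) hp]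

lemma ofReal_sum_norm_rpow (hp : 0 ≤ p) (s : Finset ℕ) (g : ℕ → B) :
    ENNReal.ofReal (∑ j ∈ s, ‖g j‖ ^ p) = ∑ j ∈ s, ‖g j‖ₑ ^ p := by
  rw [ENNReal.ofReal_sum_of_nonneg fun _ _ => by positivity]
  simp only [enorm_rpow_eq_ofReal hp]

variable [NormedSpace ℝ B]

lemma shiftAvg_mul (J M : ℕ) (f : ℤ → B) (y : ℤ) :
    shiftAvg (J * M) f y = (J : ℝ)⁻¹ • ∑ j ∈ range J, shiftAvg M f (y + (j * M : ℕ)) := by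
  have hsum : ∀ J : ℕ, ∑ i ∈ range (J * M), f (y + (i : ℤ)) =
      ∑ j ∈ range J, ∑ i ∈ range M, f (y + (j * M : ℕ) + (i : ℤ)) := fun J => by
    induction J with
    | zero => simp
    | succ J ih =>
      rw [Nat.succ_mul, Finset.sum_range_add, ih, Finset.sum_range_succ]
      simp only [Nat.cast_add, add_assoc]
  simp only [shiftAvg]
  rw [hsum, ← Finset.smul_sum, smul_smul]
  congr 1
  push_cast
  exact mul_inv _ _

lemma shiftAvg_add_sub {a h : ℕ} (ha : 0 < a) (hh : 0 < h) (f : ℤ → B) (x : ℤ) :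
    shiftAvg (a + h) f x - shiftAvg a f x =
      ((h : ℝ) / (a + h)) • (shiftAvg h f (x + a) - shiftAvg a f x) := by
  have ha' : (a : ℝ) ≠ 0 := by exact_mod_cast ha.ne'
  have hh' : (h : ℝ) ≠ 0 := by exact_mod_cast hh.ne'
  have hah : (a : ℝ) + h ≠ 0 := by positivity
  simp only [shiftAvg]
  rw [Finset.sum_range_add]
  simp only [Nat.cast_add, ← add_assoc]
  set S := ∑ i ∈ range a, f (x + (i : ℤ))
  set T := ∑ i ∈ range h, f (x + (a : ℤ) + (i : ℤ))
  match_scalars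
  · field_simp
    ring
  · field_simp

/-- The energy of the deviations of the averages of length `M` from those of length `J * M`. -/
noncomputable def deviation (p : ℝ) (f : ℤ → B) (J M : ℕ) : ℝ≥0∞ :=
  ∑' y : ℤ, ∑ j ∈ range J, ‖shiftAvg M f (y + (j * M : ℕ)) - shiftAvg (J * M) f y‖ₑ ^ p

lemma HasConvexityModulus.lpSum_add_deviation_le (hB : HasConvexityModulus B p K) (hp : 2 ≤ p)
    (hK : 0 < K) {J : ℕ} (hJ : 0 < J) (M : ℕ) (f : ℤ → B) :
    J * lpSum p (shiftAvg (J * M) f)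
        + ENNReal.ofReal (2 * convexityConst p K) * deviation p f J M
      ≤ J * lpSum p (shiftAvg M f) := by
  have hp0 : 0 ≤ p := by linarith
  have hc := (convexityConst_pos (p := p) hK).le
  have hright : (J : ℝ≥0∞) * lpSum p (shiftAvg M f) =
      ∑' y : ℤ, ∑ j ∈ range J, ‖shiftAvg M f (y + (j * M : ℕ))‖ₑ ^ p := by
    rw [Summable.tsum_finsetSum fun _ _ => ENNReal.summable]
    simp only [tsum_int_add (fun x => ‖shiftAvg M f x‖ₑ ^ p)]
    rw [Finset.sum_const, card_range, nsmul_eq_mul, lpSum]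
  rw [hright, lpSum, deviation, ← ENNReal.tsum_mul_left, ← ENNReal.tsum_mul_left,
    ← ENNReal.tsum_add]
  refine ENNReal.tsum_le_tsum fun y => ?_
  have key := hB.average hp hK hJ fun j => shiftAvg M f (y + (j * M : ℕ))
  rw [← shiftAvg_mul] at key
  have := ENNReal.ofReal_le_ofReal key
  rw [ENNReal.ofReal_add (by positivity) (by positivity), ENNReal.ofReal_mul (by positivity),
    ENNReal.ofReal_mul (by positivity), ofReal_sum_norm_rpow hp0, ofReal_sum_norm_rpow hp0,
    ← enorm_rpow_eq_ofReal hp0, ENNReal.ofReal_natCast] at this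
  exact this

/-- The `p`-th power of the `ℓᵖ` norm of the dyadic averages. -/
noncomputable def dyadicEnergy (p : ℝ) (f : ℤ → B) (n : ℕ) : ℝ≥0∞ := lpSum p (shiftAvg (2 ^ n) f)

/-- The loss of energy from one dyadic scale to the next. -/
noncomputable def energyDrop (p : ℝ) (f : ℤ → B) (n : ℕ) : ℝ≥0∞ :=
  dyadicEnergy p f n - dyadicEnergy p f (n + 1)

lemma dyadicEnergy_zero (f : ℤ → B) : dyadicEnergy p f 0 = lpSum p f := by
  simp [dyadicEnergy, lpSum, shiftAvg]

lemma HasConvexityModulus.dyadicEnergy_antitone (hB : HasConvexityModulus B p K) (hp : 2 ≤ p)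
    (hK : 0 < K) (f : ℤ → B) : Antitone (dyadicEnergy p f) := by
  refine antitone_nat_of_succ_le fun n => ?_
  have := le_self_add.trans (hB.lpSum_add_deviation_le hp hK two_pos (2 ^ n) f)
  rw [← pow_succ'] at this
  exact (ENNReal.mul_le_mul_iff_right (by simp) (by simp)).mp this

lemma HasConvexityModulus.sum_energyDrop_le (hB : HasConvexityModulus B p K) (hp : 2 ≤ p)
    (hK : 0 < K) (f : ℤ → B) : ∑' n, energyDrop p f n ≤ lpSum p f := by
  refine ENNReal.tsum_le_of_sum_range_le fun n => ?_
  have : ∑ i ∈ range n, energyDrop p f i + dyadicEnergy p f n ≤ lpSum p f := by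
    induction n with
    | zero => simp [dyadicEnergy_zero]
    | succ n ih =>
      rwa [Finset.sum_range_succ, add_assoc, energyDrop,
        tsub_add_cancel_of_le (hB.dyadicEnergy_antitone hp hK f n.le_succ)]
  exact le_self_add.trans this

lemma dyadicEnergy_le_add_sum (f : ℤ → B) (m d : ℕ) :
    dyadicEnergy p f m ≤ dyadicEnergy p f (m + d)
      + ∑ i ∈ range d, energyDrop p f (m + i) := by
  induction d with
  | zero => simp
  | succ d ih =>
    have h : dyadicEnergy p f (m + d) ≤ energyDrop p f (m + d) + dyadicEnergy p f (m + d + 1) :=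
      le_tsub_add
    calc dyadicEnergy p f m ≤ _ := ih
      _ ≤ energyDrop p f (m + d) + dyadicEnergy p f (m + d + 1)
          + ∑ i ∈ range d, energyDrop p f (m + i) := by gcongr
      _ = _ := by rw [Finset.sum_range_succ, ← add_assoc m d 1]; ring

lemma HasConvexityModulus.deviation_le (hB : HasConvexityModulus B p K) (hp : 2 ≤ p)
    (hK : 0 < K) {f : ℤ → B} (hf : lpSum p f ≠ ∞) (m d : ℕ) :
    deviation p f (2 ^ d) (2 ^ m) ≤ (2 : ℝ≥0∞) ^ d *
      (ENNReal.ofReal (2 * convexityConst p K))⁻¹ * ∑ i ∈ range d, energyDrop p f (m + i) := by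
  have hc : ENNReal.ofReal (2 * convexityConst p K) ≠ 0 := by
    have := convexityConst_pos (p := p) hK
    simpa using this
  have h1 := hB.lpSum_add_deviation_le hp hK (J := 2 ^ d) (by positivity) (2 ^ m) f
  have hfin : dyadicEnergy p f (m + d) ≠ ∞ := by
    refine ne_top_of_le_ne_top hf ?_
    rw [← dyadicEnergy_zero]
    exact hB.dyadicEnergy_antitone hp hK f (Nat.zero_le _)
  have h2 : lpSum p (shiftAvg (2 ^ d * 2 ^ m) f) = dyadicEnergy p f (m + d) := by
    rw [dyadicEnergy, pow_add, mul_comm]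
  rw [h2] at h1
  change _ ≤ _ * dyadicEnergy p f m at h1
  have h3 := h1.trans (mul_le_mul_right (dyadicEnergy_le_add_sum f m d) _)
  rw [mul_add] at h3
  have h4 := (ENNReal.add_le_add_iff_left (by finiteness)).mp h3
  rw [mul_assoc, ← mul_left_comm, ← ENNReal.div_eq_inv_mul, ENNReal.le_div_iff_mul_le
    (Or.inl hc) (Or.inl ENNReal.ofReal_ne_top), mul_comm]
  simpa using h4

end Averages

section LongOscillation

variable {B : Type*} [NormedAddCommGroup B] [NormedSpace ℝ B] {p K : ℝ}

/-- The oscillation of the dyadic averages at `x` between the scales `m` and `l`. -/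
noncomputable def dyadicOsc (p : ℝ) (f : ℤ → B) (m l : ℕ) (x : ℤ) : ℝ≥0∞ :=
  ⨆ n ∈ Set.Icc m l, ⨆ n' ∈ Set.Icc m l,
    ‖shiftAvg (2 ^ n) f x - shiftAvg (2 ^ n') f x‖ₑ ^ p

lemma sum_dyadicOsc_le (hp : 2 ≤ p) (f : ℤ → B) (m d : ℕ) (y : ℤ) :
    ∑ j ∈ range (2 ^ d), dyadicOsc p f m (m + d) (y + (j * 2 ^ m : ℕ)) ≤
      (2 : ℝ≥0∞) ^ p * 4 * ∑ j ∈ range (2 ^ (d + 1)),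
        ‖shiftAvg (2 ^ m) f (y + (j * 2 ^ m : ℕ)) - shiftAvg (2 ^ (d + 1) * 2 ^ m) f y‖ₑ ^ p := by
  have hp0 : 0 ≤ p := by linarith
  set c := shiftAvg (2 ^ (d + 1) * 2 ^ m) f y with hc
  have hex : ∀ j : ℕ, ∃ n ∈ Finset.Icc m (m + d), ∀ n' ∈ Finset.Icc m (m + d),
      ‖shiftAvg (2 ^ n') f (y + (j * 2 ^ m : ℕ)) - c‖ ≤
        ‖shiftAvg (2 ^ n) f (y + (j * 2 ^ m : ℕ)) - c‖ := fun j =>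
    Finset.exists_max_image _ _ ⟨m, by simp⟩
  choose N hN hmax using hex
  set b : ℕ → B := fun j => shiftAvg (2 ^ N j) f (y + (j * 2 ^ m : ℕ)) - c with hb
  set h : ℕ → B := fun j => shiftAvg (2 ^ m) f (y + (j * 2 ^ m : ℕ)) - c with hh
  have hosc : ∀ j, dyadicOsc p f m (m + d) (y + (j * 2 ^ m : ℕ)) ≤ 2 ^ p * ‖b j‖ₑ ^ p := by
    intro j
    refine iSup₂_le fun n hn => iSup₂_le fun n' hn' => ?_
    rw [← ENNReal.mul_rpow_of_nonneg _ _ hp0, two_mul]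
    refine ENNReal.rpow_le_rpow ?_ hp0
    have hle : ∀ n ∈ Set.Icc m (m + d),
        ‖shiftAvg (2 ^ n) f (y + (j * 2 ^ m : ℕ)) - c‖ₑ ≤ ‖b j‖ₑ := fun n hn =>
      enorm_le_iff_norm_le.mpr (hmax j n (Finset.mem_Icc.mpr hn))
    rw [← sub_sub_sub_cancel_right _ _ c]
    exact (enorm_sub_le).trans (add_le_add (hle n hn) (hle n' hn'))
  have havg : ∀ (j n : ℕ), m ≤ n →
      ((2 ^ (n - m) : ℕ) : ℝ) * ‖shiftAvg (2 ^ n) f (y + (j * 2 ^ m : ℕ)) - c‖ ≤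
        ∑ i ∈ range (2 ^ (n - m)), ‖h (j + i)‖ := by
    intro j n hn
    have h1 : (2 : ℕ) ^ n = 2 ^ (n - m) * 2 ^ m := by rw [← pow_add, Nat.sub_add_cancel hn]
    have hpos : ((2 ^ (n - m) : ℕ) : ℝ) ≠ 0 := by positivity
    have h2 : ((2 ^ (n - m) : ℕ) : ℝ) • (shiftAvg (2 ^ n) f (y + (j * 2 ^ m : ℕ)) - c) =
        ∑ i ∈ range (2 ^ (n - m)), h (j + i) := by
      rw [h1, shiftAvg_mul, smul_sub, smul_smul, mul_inv_cancel₀ hpos, one_smul]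
      simp only [hh, Finset.sum_sub_distrib, Finset.sum_const, card_range]
      rw [← Nat.cast_smul_eq_nsmul ℝ]
      congr 1
      refine Finset.sum_congr rfl fun i _ => ?_
      congr 1
      push_cast
      ring
    calc _ = ‖((2 ^ (n - m) : ℕ) : ℝ) • (shiftAvg (2 ^ n) f (y + (j * 2 ^ m : ℕ)) - c)‖ := by
          rw [norm_smul, Real.norm_of_nonneg (Nat.cast_nonneg _)]
      _ ≤ _ := by rw [h2]; exact norm_sum_le _ _
  have hmaxineq : ∑ j ∈ range (2 ^ d), ‖b j‖ ^ p ≤ 4 * ∑ j ∈ range (2 ^ (d + 1)), ‖h j‖ ^ p := by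
    have hdd : (2 : ℕ) ^ (d + 1) = 2 ^ d + 2 ^ d := by ring
    have key := sum_rpow_le_of_le_average hp (L := 2 ^ (d + 1)) (h := fun j => ‖h j‖)
      (a := fun j => if j < 2 ^ d then ‖b j‖ else 0) (fun _ => norm_nonneg _)
      (fun j => by split_ifs <;> positivity) (fun j hj => ?_)
    · refine le_trans ?_ key
      rw [hdd, Finset.sum_range_add]
      refine le_add_of_le_of_nonneg (Finset.sum_le_sum fun j hj => ?_)
        (Finset.sum_nonneg fun j _ => Real.rpow_nonneg (by split_ifs <;> positivity) _)
      rw [if_pos (Finset.mem_range.mp hj)]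
    · split_ifs with hjd
      · have hNj := Finset.mem_Icc.mp (hN j)
        refine ⟨2 ^ (N j - m), by positivity, ?_, havg j (N j) hNj.1⟩
        have : (2 : ℕ) ^ (N j - m) ≤ 2 ^ d := Nat.pow_le_pow_right two_pos (by omega)
        omega
      · exact ⟨1, one_pos, hj, by simp⟩
  calc _ ≤ ∑ j ∈ range (2 ^ d), 2 ^ p * ‖b j‖ₑ ^ p := Finset.sum_le_sum fun j _ => hosc j
    _ = 2 ^ p * ENNReal.ofReal (∑ j ∈ range (2 ^ d), ‖b j‖ ^ p) := by
        rw [← Finset.mul_sum, ofReal_sum_norm_rpow hp0]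
    _ ≤ 2 ^ p * ENNReal.ofReal (4 * ∑ j ∈ range (2 ^ (d + 1)), ‖h j‖ ^ p) := by gcongr
    _ = _ := by
        rw [ENNReal.ofReal_mul (by norm_num), ofReal_sum_norm_rpow hp0, mul_assoc]
        simp [hh]

lemma HasConvexityModulus.tsum_dyadicOsc_le (hB : HasConvexityModulus B p K) (hp : 2 ≤ p)
    (hK : 0 < K) {f : ℤ → B} (hf : lpSum p f ≠ ∞) (m d : ℕ) :
    ∑' x, dyadicOsc p f m (m + d) x ≤
      (2 : ℝ≥0∞) ^ p * 8 * (ENNReal.ofReal (2 * convexityConst p K))⁻¹ *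
        ∑ i ∈ range (d + 1), energyDrop p f (m + i) := by
  have h1 : (2 : ℝ≥0∞) ^ d * ∑' x, dyadicOsc p f m (m + d) x =
      ∑' y : ℤ, ∑ j ∈ range (2 ^ d), dyadicOsc p f m (m + d) (y + (j * 2 ^ m : ℕ)) := by
    rw [Summable.tsum_finsetSum fun _ _ => ENNReal.summable]
    simp only [tsum_int_add (fun x => dyadicOsc p f m (m + d) x)]
    simp
  have h2 : (2 : ℝ≥0∞) ^ d * ∑' x, dyadicOsc p f m (m + d) x ≤
      2 ^ p * 4 * deviation p f (2 ^ (d + 1)) (2 ^ m) := by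
    rw [h1, deviation, ← ENNReal.tsum_mul_left]
    exact ENNReal.tsum_le_tsum fun y => sum_dyadicOsc_le hp f m d y
  have h3 := h2.trans (mul_le_mul_right (hB.deviation_le hp hK hf m (d + 1)) _)
  refine (ENNReal.mul_le_mul_iff_right (a := (2 : ℝ≥0∞) ^ d) (by simp) (by simp)).mp
    (h3.trans_eq ?_)
  rw [pow_succ]
  ring

end LongOscillation

section Chaining

/-- Dyadic chaining: an increment is controlled by the dyadic increments inside the interval. -/
lemma enorm_sub_le_sum_dyadic {B : Type*} [NormedAddCommGroup B] (n : ℕ) (F : ℕ → B)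
    (m : ℕ → ℝ≥0∞) {u v : ℕ} (huv : u ≤ v) (hv : v ≤ 2 ^ n)
    (hm : ∀ i b, u ≤ b * 2 ^ i → (b + 1) * 2 ^ i ≤ v →
      ‖F ((b + 1) * 2 ^ i) - F (b * 2 ^ i)‖ₑ ≤ m i) :
    ‖F v - F u‖ₑ ≤ 2 * ∑ i ∈ range (n + 1), m i := by
  have hstep : ∀ w, u ≤ w → w + 1 ≤ v → ‖F (w + 1) - F w‖ₑ ≤ m 0 := fun w h1 h2 => by
    simpa using hm 0 w (by simpa using h1) (by simpa using h2)
  rcases huv.eq_or_lt with rfl | hlt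
  · simp
  induction n generalizing F m u v with
  | zero =>
    obtain rfl : v = u + 1 := by simp at hv; omega
    refine (hstep u le_rfl le_rfl).trans ?_
    simp [two_mul]
  | succ n ih =>
    have hleft : ‖F (2 * ((u + 1) / 2)) - F u‖ₑ ≤ m 0 := by
      rcases Nat.even_or_odd' u with ⟨w, rfl | rfl⟩
      · rw [show 2 * ((2 * w + 1) / 2) = 2 * w by omega]
        simp
      · rw [show 2 * ((2 * w + 1 + 1) / 2) = 2 * w + 1 + 1 by omega]
        exact hstep _ le_rfl hlt
    have hright : ‖F v - F (2 * (v / 2))‖ₑ ≤ m 0 := by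
      rcases Nat.even_or_odd' v with ⟨w, rfl | rfl⟩
      · rw [show 2 * (2 * w / 2) = 2 * w by omega]
        simp
      · rw [show 2 * ((2 * w + 1) / 2) = 2 * w by omega]
        exact hstep _ (by omega) le_rfl
    have hmid : ‖F (2 * (v / 2)) - F (2 * ((u + 1) / 2))‖ₑ ≤
        2 * ∑ i ∈ range (n + 1), m (i + 1) := by
      rcases (show (u + 1) / 2 ≤ v / 2 by omega).eq_or_lt with heq | hlt'
      · simp [heq]
      have hm' : ∀ i b, (u + 1) / 2 ≤ b * 2 ^ i → (b + 1) * 2 ^ i ≤ v / 2 →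
          ‖F (2 * ((b + 1) * 2 ^ i)) - F (2 * (b * 2 ^ i))‖ₑ ≤ m (i + 1) := fun i b h1 h2 => by
        have e1 : 2 * ((b + 1) * 2 ^ i) = (b + 1) * 2 ^ (i + 1) := by ring
        have e2 : 2 * (b * 2 ^ i) = b * 2 ^ (i + 1) := by ring
        rw [e1, e2]
        exact hm _ _ (by omega) (by omega)
      exact ih (fun w => F (2 * w)) (fun i => m (i + 1)) hlt'.le (by rw [pow_succ] at hv; omega)
        hm' (fun w h1 h2 => by
          simpa using hm' 0 w (by simpa using h1) (by simpa using h2)) hlt'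
    have hsplit : F v - F u = (F v - F (2 * (v / 2))) +
        (F (2 * (v / 2)) - F (2 * ((u + 1) / 2))) + (F (2 * ((u + 1) / 2)) - F u) := by abel
    rw [hsplit, Finset.sum_range_succ']
    refine ((enorm_add_le _ _).trans (add_le_add (enorm_add_le _ _) le_rfl)).trans ?_
    calc _ ≤ m 0 + 2 * ∑ i ∈ range (n + 1), m (i + 1) + m 0 := by gcongr
      _ = _ := by ring

/-- The weights used to sum over dyadic scales. -/
noncomputable def scaleWeight (p : ℝ) (j : ℕ) : ℝ≥0∞ :=
  (((j + 1) * (j + 2) : ℕ) : ℝ≥0∞) ^ (p - 1)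

lemma sum_inv_mul_le_one (N : ℕ) :
    ∑ j ∈ range N, (((j + 1) * (j + 2) : ℕ) : ℝ≥0∞)⁻¹ ≤ 1 := by
  have hreal : ∀ N : ℕ, ∑ j ∈ range N, (((j + 1) * (j + 2) : ℕ) : ℝ)⁻¹ = 1 - 1 / (N + 1) :=
    fun N => by
      induction N with
      | zero => simp
      | succ N ih =>
        rw [Finset.sum_range_succ, ih]
        push_cast
        field_simp
        ring
  have hconv : ∀ j : ℕ, (((j + 1) * (j + 2) : ℕ) : ℝ≥0∞)⁻¹ =
      ENNReal.ofReal (((j + 1) * (j + 2) : ℕ) : ℝ)⁻¹ := fun j => by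
    rw [ENNReal.ofReal_inv_of_pos (by positivity), ENNReal.ofReal_natCast]
  simp only [hconv]
  rw [← ENNReal.ofReal_sum_of_nonneg fun _ _ => by positivity, hreal]
  refine ENNReal.ofReal_le_one.mpr ?_
  have : (0 : ℝ) ≤ 1 / (N + 1) := by positivity
  linarith

lemma rpow_sum_le_sum_scaleWeight {p : ℝ} (hp : 1 ≤ p) (N : ℕ) (c : ℕ → ℝ≥0∞) :
    (∑ j ∈ range N, c j) ^ p ≤ ∑ j ∈ range N, scaleWeight p j * c j ^ p := by
  set W : ℕ → ℝ≥0∞ := fun j => (((j + 1) * (j + 2) : ℕ) : ℝ≥0∞) with hW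
  have hW0 : ∀ j, W j ≠ 0 := fun j => Nat.cast_ne_zero.mpr (by positivity)
  have hWt : ∀ j, W j ≠ ∞ := fun j => ENNReal.natCast_ne_top _
  have hp0 : 0 < p := by linarith
  have key := ENNReal.inner_le_weight_mul_Lp_of_nonneg (range N) hp (fun j => (W j)⁻¹)
    (fun j => W j * c j)
  have e1 : ∀ j, (W j)⁻¹ * (W j * c j) = c j := fun j => by
    rw [← mul_assoc, ENNReal.inv_mul_cancel (hW0 j) (hWt j), one_mul]
  have e2 : ∀ j, (W j)⁻¹ * (W j * c j) ^ p = scaleWeight p j * c j ^ p := fun j => by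
    rw [ENNReal.mul_rpow_of_nonneg _ _ hp0.le, ← mul_assoc, scaleWeight,
      ENNReal.rpow_sub _ _ (hW0 j) (hWt j), ENNReal.rpow_one, ENNReal.div_eq_inv_mul]
  simp only [e1, e2] at key
  have hone : (∑ j ∈ range N, (W j)⁻¹) ^ (1 - p⁻¹) ≤ 1 :=
    ENNReal.rpow_le_one (sum_inv_mul_le_one N) (sub_nonneg.mpr (inv_le_one_of_one_le₀ hp))
  have h2 := key.trans (mul_le_of_le_one_left' hone)
  calc _ ≤ ((∑ j ∈ range N, scaleWeight p j * c j ^ p) ^ p⁻¹) ^ p :=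
        ENNReal.rpow_le_rpow h2 hp0.le
    _ = _ := by rw [← ENNReal.rpow_mul, inv_mul_cancel₀ hp0.ne', ENNReal.rpow_one]

end Chaining

section BlockVariation

variable {B : Type*} [NormedAddCommGroup B] [NormedSpace ℝ B] {p K : ℝ}

/-- The `p`-th power of a dyadic increment of `u ↦ A_u f x` inside `[2 ^ n, 2 ^ (n + 1)]`. -/
noncomputable def blockIncr (p : ℝ) (f : ℤ → B) (n j b : ℕ) (x : ℤ) : ℝ≥0∞ :=
  ‖shiftAvg (2 ^ n + (b + 1) * 2 ^ (n - j)) f x - shiftAvg (2 ^ n + b * 2 ^ (n - j)) f x‖ₑ ^ p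

/-- The weighted sum of the dyadic increments in `[2 ^ n, 2 ^ (n + 1)]` lying in `[s, t]`. -/
noncomputable def blockVar (p : ℝ) (f : ℤ → B) (n s t : ℕ) (x : ℤ) : ℝ≥0∞ :=
  ∑ j ∈ range (n + 1), scaleWeight p j * ∑ b ∈ range (2 ^ j),
    if s ≤ 2 ^ n + b * 2 ^ (n - j) ∧ 2 ^ n + (b + 1) * 2 ^ (n - j) ≤ t
      then blockIncr p f n j b x else 0

/-- The weighted sum of all dyadic increments in `[2 ^ n, 2 ^ (n + 1)]`. -/
noncomputable def blockTotal (p : ℝ) (f : ℤ → B) (n : ℕ) (x : ℤ) : ℝ≥0∞ :=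
  ∑ j ∈ range (n + 1), scaleWeight p j * ∑ b ∈ range (2 ^ j), blockIncr p f n j b x

lemma blockVar_le_blockTotal (f : ℤ → B) (n s t : ℕ) (x : ℤ) :
    blockVar p f n s t x ≤ blockTotal p f n x := by
  unfold blockVar blockTotal
  gcongr
  split_ifs
  · exact le_rfl
  · exact zero_le

lemma enorm_shiftAvg_sub_le_blockVar (hp : 1 ≤ p) (f : ℤ → B) (x : ℤ) {n s t u v : ℕ}
    (hn : 2 ^ n ≤ u) (hsu : s ≤ u) (huv : u ≤ v) (hvt : v ≤ t) (hv : v ≤ 2 ^ (n + 1)) :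
    ‖shiftAvg v f x - shiftAvg u f x‖ₑ ^ p ≤ 2 ^ p * blockVar p f n s t x := by
  have hp0 : 0 < p := by linarith
  obtain ⟨u, rfl⟩ := Nat.exists_eq_add_of_le hn
  obtain ⟨v, rfl⟩ := Nat.exists_eq_add_of_le (hn.trans huv)
  set S : ℕ → ℝ≥0∞ := fun j => ∑ b ∈ range (2 ^ j),
    if s ≤ 2 ^ n + b * 2 ^ (n - j) ∧ 2 ^ n + (b + 1) * 2 ^ (n - j) ≤ t
      then blockIncr p f n j b x else 0 with hS
  have hv' : v ≤ 2 ^ n := by rw [pow_succ] at hv; omega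
  have hchain := enorm_sub_le_sum_dyadic n (fun w => shiftAvg (2 ^ n + w) f x)
    (fun i => S (n - i) ^ p⁻¹) (u := u) (v := v) (by omega) hv' (fun i b h1 h2 => ?_)
  · have hrefl := Finset.sum_range_reflect (fun i => S i ^ p⁻¹) (n + 1)
    simp only [Nat.add_sub_cancel] at hrefl
    rw [hrefl] at hchain
    calc _ ≤ (2 * ∑ j ∈ range (n + 1), S j ^ p⁻¹) ^ p := ENNReal.rpow_le_rpow hchain hp0.le
      _ = 2 ^ p * (∑ j ∈ range (n + 1), S j ^ p⁻¹) ^ p := ENNReal.mul_rpow_of_nonneg _ _ hp0.le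
      _ ≤ 2 ^ p * ∑ j ∈ range (n + 1), scaleWeight p j * (S j ^ p⁻¹) ^ p := by
          gcongr; exact rpow_sum_le_sum_scaleWeight hp _ _
      _ = _ := by
          simp only [← ENNReal.rpow_mul, inv_mul_cancel₀ hp0.ne', ENNReal.rpow_one]
          rfl
  · have hb : (b + 1) * 2 ^ i ≤ 2 ^ n := h2.trans hv'
    have hi : i ≤ n := by
      refine (Nat.pow_le_pow_iff_right one_lt_two).mp (le_trans ?_ hb)
      exact Nat.le_mul_of_pos_left _ (Nat.succ_pos b)
    have hb' : b < 2 ^ (n - i) := by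
      have : (b + 1) * 2 ^ i ≤ 2 ^ (n - i) * 2 ^ i := by
        rwa [← pow_add, Nat.sub_add_cancel hi]
      exact Nat.le_of_mul_le_mul_right this (by positivity)
    have hni : n - (n - i) = i := by omega
    have hle : blockIncr p f n (n - i) b x ≤ S (n - i) := by
      have := Finset.single_le_sum (s := range (2 ^ (n - i)))
        (f := fun b => if s ≤ 2 ^ n + b * 2 ^ (n - (n - i)) ∧
          2 ^ n + (b + 1) * 2 ^ (n - (n - i)) ≤ t
            then blockIncr p f n (n - i) b x else 0) (fun _ _ => zero_le)
        (Finset.mem_range.mpr hb')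
      refine le_trans ?_ this
      rw [if_pos]
      rw [hni]
      omega
    rw [blockIncr, hni] at hle
    exact (ENNReal.le_rpow_inv_iff hp0).mpr hle

/-- A sum over indices of which at most one is active. -/
lemma tsum_ite_le_of_subsingleton {P : ℕ → Prop} [DecidablePred P] (a : ℝ≥0∞)
    (hP : ∀ k l, P k → P l → k = l) : ∑' k, (if P k then a else 0) ≤ a := by
  by_cases h : ∃ k, P k
  · obtain ⟨k, hk⟩ := h
    rw [tsum_eq_single k fun l hl => if_neg fun h => hl (hP l k h hk), if_pos hk]
  · push Not at h
    simp [h]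

lemma tsum_blockVar_le (f : ℤ → B) (n : ℕ) {t : ℕ → ℕ} (ht : StrictMono t) (x : ℤ) :
    ∑' k, blockVar p f n (t k) (t (k + 1)) x ≤ blockTotal p f n x := by
  unfold blockVar blockTotal
  rw [Summable.tsum_finsetSum fun _ _ => ENNReal.summable]
  refine Finset.sum_le_sum fun j _ => ?_
  rw [ENNReal.tsum_mul_left, Summable.tsum_finsetSum fun _ _ => ENNReal.summable]
  gcongr with b _
  refine tsum_ite_le_of_subsingleton _ fun k l hk hl => ?_
  have hlt : 2 ^ n + b * 2 ^ (n - j) < 2 ^ n + (b + 1) * 2 ^ (n - j) := by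
    have : 0 < 2 ^ (n - j) := by positivity
    rw [Nat.succ_mul]
    omega
  have h1 : t k < t (l + 1) := by omega
  have h2 : t l < t (k + 1) := by omega
  rw [ht.lt_iff_lt] at h1 h2
  omega

end BlockVariation

section BlockBounds

variable {B : Type*} [NormedAddCommGroup B] [NormedSpace ℝ B] {p K : ℝ}

lemma HasConvexityModulus.lpSum_child_sub_le (hB : HasConvexityModulus B p K) (hp : 2 ≤ p)
    (hK : 0 < K) {f : ℤ → B} (hf : lpSum p f ≠ ∞) (l : ℕ) {r : ℕ} (hr : r < 2) :
    lpSum p (fun x => shiftAvg (2 ^ l) f (x + (r * 2 ^ l : ℕ)) - shiftAvg (2 ^ (l + 1)) f x) ≤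
      2 * (ENNReal.ofReal (2 * convexityConst p K))⁻¹ * energyDrop p f l := by
  have h := hB.deviation_le hp hK hf l 1
  simp only [pow_one, Finset.range_one, Finset.sum_singleton, add_zero] at h
  refine le_trans (ENNReal.tsum_le_tsum fun y => ?_) h
  rw [pow_succ' 2 l]
  exact Finset.single_le_sum (f := fun j : ℕ =>
    ‖shiftAvg (2 ^ l) f (y + (j * 2 ^ l : ℕ)) - shiftAvg (2 * 2 ^ l) f y‖ₑ ^ p)
    (fun _ _ => zero_le) (Finset.mem_range.mpr hr)

lemma HasConvexityModulus.lpSum_descendant_sub_le (hB : HasConvexityModulus B p K) (hp : 2 ≤ p)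
    (hK : 0 < K) {f : ℤ → B} (hf : lpSum p f ≠ ∞) (i m : ℕ) {b : ℕ} (hb : b < 2 ^ m) :
    lpSum p (fun x => shiftAvg (2 ^ i) f (x + (b * 2 ^ i : ℕ)) - shiftAvg (2 ^ (i + m)) f x) ≤
      (m : ℝ≥0∞) ^ (p - 1) * ∑ j ∈ range m,
        2 * (ENNReal.ofReal (2 * convexityConst p K))⁻¹ * energyDrop p f (i + j) := by
  have hp0 : 0 ≤ p := by linarith
  set z : ℕ → ℤ → B := fun j x =>
    shiftAvg (2 ^ (i + j)) f (x + (b / 2 ^ j * 2 ^ (i + j) : ℕ)) with hz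
  have hstep : ∀ j, lpSum p (fun x => z j x - z (j + 1) x) ≤
      2 * (ENNReal.ofReal (2 * convexityConst p K))⁻¹ * energyDrop p f (i + j) := fun j => by
    have hmod : b / 2 ^ j = 2 * (b / 2 ^ (j + 1)) + b / 2 ^ j % 2 := by
      rw [pow_succ, ← Nat.div_div_eq_div_mul]
      exact (Nat.div_add_mod _ 2).symm
    refine le_trans (le_of_eq ?_) (hB.lpSum_child_sub_le hp hK hf (i + j)
      (Nat.mod_lt (b / 2 ^ j) two_pos))
    refine Eq.trans ?_ (lpSum_translate p _ ((b / 2 ^ (j + 1) * 2 ^ (i + (j + 1)) : ℕ) : ℤ))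
    congr 1
    ext x
    simp only [hz]
    congr 2
    rw [add_assoc, ← Nat.cast_add]
    congr 2
    conv_lhs => rw [hmod]
    ring
  have hpt : ∀ x, ‖shiftAvg (2 ^ i) f (x + (b * 2 ^ i : ℕ)) - shiftAvg (2 ^ (i + m)) f x‖ₑ ^ p ≤
      (m : ℝ≥0∞) ^ (p - 1) * ∑ j ∈ range m, ‖z j x - z (j + 1) x‖ₑ ^ p := fun x => by
    have h1 := edist_le_range_sum_edist (fun j => z j x) m
    simp only [edist_eq_enorm_sub] at h1
    have h0 : z 0 x = shiftAvg (2 ^ i) f (x + (b * 2 ^ i : ℕ)) := by simp [hz]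
    have hm : z m x = shiftAvg (2 ^ (i + m)) f x := by
      simp only [hz]
      rw [Nat.div_eq_of_lt hb]
      simp
    rw [h0, hm] at h1
    refine (ENNReal.rpow_le_rpow h1 hp0).trans ?_
    have := ENNReal.rpow_sum_le_const_mul_sum_rpow (range m)
      (fun j => ‖z j x - z (j + 1) x‖ₑ) (p := p) (by linarith)
    rwa [card_range] at this
  calc _ ≤ ∑' x, (m : ℝ≥0∞) ^ (p - 1) * ∑ j ∈ range m, ‖z j x - z (j + 1) x‖ₑ ^ p :=
        ENNReal.tsum_le_tsum hpt
    _ = (m : ℝ≥0∞) ^ (p - 1) * ∑ j ∈ range m, lpSum p (fun x => z j x - z (j + 1) x) := by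
        rw [ENNReal.tsum_mul_left, Summable.tsum_finsetSum fun _ _ => ENNReal.summable]
        rfl
    _ ≤ _ := by gcongr with j _; exact hstep j

lemma enorm_average_rpow_le (hp : 1 ≤ p) {β : ℕ} (hβ : 0 < β) (z : ℕ → B) :
    ‖(β : ℝ)⁻¹ • ∑ j ∈ range β, z j‖ₑ ^ p ≤ (β : ℝ≥0∞)⁻¹ * ∑ j ∈ range β, ‖z j‖ₑ ^ p := by
  have hβ0 : (β : ℝ≥0∞) ≠ 0 := by exact_mod_cast hβ.ne'
  have hnorm : ‖(β : ℝ)⁻¹ • ∑ j ∈ range β, z j‖ₑ ≤ ∑ j ∈ range β, (β : ℝ≥0∞)⁻¹ * ‖z j‖ₑ := by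
    rw [enorm_smul, ← Finset.mul_sum]
    have : ‖(β : ℝ)⁻¹‖ₑ = (β : ℝ≥0∞)⁻¹ := by
      rw [enorm_inv (by exact_mod_cast hβ.ne'), Real.enorm_natCast]
    rw [this]
    gcongr
    exact enorm_sum_le _ _
  refine (ENNReal.rpow_le_rpow hnorm (by linarith)).trans ?_
  rw [Finset.mul_sum]
  refine ENNReal.rpow_arith_mean_le_arith_mean_rpow (range β) _ _ ?_ hp
  rw [Finset.sum_const, card_range, nsmul_eq_mul,
    ENNReal.mul_inv_cancel hβ0 (ENNReal.natCast_ne_top _)]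

lemma HasConvexityModulus.lpSum_next_sub_le (hB : HasConvexityModulus B p K) (hp : 2 ≤ p)
    (hK : 0 < K) {f : ℤ → B} (hf : lpSum p f ≠ ∞) (i m : ℕ) {β : ℕ} (hβ0 : 0 < β)
    (hβ : β < 2 ^ m) :
    lpSum p (fun x => shiftAvg (2 ^ i) f (x + (β * 2 ^ i : ℕ)) - shiftAvg (β * 2 ^ i) f x) ≤
      2 ^ p * ((m : ℝ≥0∞) ^ (p - 1) * ∑ j ∈ range m,
        2 * (ENNReal.ofReal (2 * convexityConst p K))⁻¹ * energyDrop p f (i + j)) := by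
  have hp0 : 0 ≤ p := by linarith
  have hβ' : (β : ℝ≥0∞) ≠ 0 := by exact_mod_cast hβ0.ne'
  set D := (m : ℝ≥0∞) ^ (p - 1) * ∑ j ∈ range m,
        2 * (ENNReal.ofReal (2 * convexityConst p K))⁻¹ * energyDrop p f (i + j) with hD
  set z : ℕ → ℤ → B := fun b x =>
    shiftAvg (2 ^ i) f (x + (b * 2 ^ i : ℕ)) - shiftAvg (2 ^ (i + m)) f x with hz
  have hzD : ∀ b ≤ β, lpSum p (z b) ≤ D := fun b hb =>
    hB.lpSum_descendant_sub_le hp hK hf i m (hb.trans_lt hβ)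
  have havg : ∀ x, shiftAvg (β * 2 ^ i) f x - shiftAvg (2 ^ (i + m)) f x =
      (β : ℝ)⁻¹ • ∑ b ∈ range β, z b x := fun x => by
    have : (β : ℝ) ≠ 0 := by exact_mod_cast hβ0.ne'
    rw [shiftAvg_mul]
    simp only [hz, Finset.sum_sub_distrib, Finset.sum_const, card_range]
    rw [← Nat.cast_smul_eq_nsmul ℝ, smul_sub, smul_smul, inv_mul_cancel₀ this, one_smul]
  have hpt : ∀ x, ‖shiftAvg (2 ^ i) f (x + (β * 2 ^ i : ℕ)) - shiftAvg (β * 2 ^ i) f x‖ₑ ^ p ≤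
      2 ^ (p - 1) * (‖z β x‖ₑ ^ p + (β : ℝ≥0∞)⁻¹ * ∑ b ∈ range β, ‖z b x‖ₑ ^ p) := fun x => by
    have h1 : shiftAvg (2 ^ i) f (x + (β * 2 ^ i : ℕ)) - shiftAvg (β * 2 ^ i) f x =
        z β x - (β : ℝ)⁻¹ • ∑ b ∈ range β, z b x := by
      rw [← havg]
      simp only [hz]
      abel
    rw [h1]
    calc _ ≤ (‖z β x‖ₑ + ‖(β : ℝ)⁻¹ • ∑ b ∈ range β, z b x‖ₑ) ^ p :=
          ENNReal.rpow_le_rpow enorm_sub_le hp0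
      _ ≤ 2 ^ (p - 1) * (‖z β x‖ₑ ^ p + ‖(β : ℝ)⁻¹ • ∑ b ∈ range β, z b x‖ₑ ^ p) :=
          ENNReal.rpow_add_le_mul_rpow_add_rpow _ _ (by linarith)
      _ ≤ _ := by gcongr; exact enorm_average_rpow_le (by linarith) hβ0 _
  calc _ ≤ ∑' x, 2 ^ (p - 1) * (‖z β x‖ₑ ^ p + (β : ℝ≥0∞)⁻¹ * ∑ b ∈ range β, ‖z b x‖ₑ ^ p) :=
        ENNReal.tsum_le_tsum hpt
    _ = 2 ^ (p - 1) * (lpSum p (z β) + (β : ℝ≥0∞)⁻¹ * ∑ b ∈ range β, lpSum p (z b)) := by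
        rw [ENNReal.tsum_mul_left, ENNReal.tsum_add, ENNReal.tsum_mul_left,
          Summable.tsum_finsetSum fun _ _ => ENNReal.summable]
        rfl
    _ ≤ 2 ^ (p - 1) * (D + (β : ℝ≥0∞)⁻¹ * ∑ b ∈ range β, D) := by
        gcongr with b hb
        · exact hzD β le_rfl
        · exact hzD b (Finset.mem_range.mp hb).le
    _ = 2 ^ p * D := by
        rw [Finset.sum_const, card_range, nsmul_eq_mul, ← mul_assoc (β : ℝ≥0∞)⁻¹,
          ENNReal.inv_mul_cancel hβ' (ENNReal.natCast_ne_top _), one_mul, ← two_mul, ← mul_assoc,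
          ENNReal.rpow_sub _ _ (by simp) (by simp), ENNReal.rpow_one,
          ENNReal.div_mul_cancel (by simp) (by simp)]

lemma HasConvexityModulus.tsum_blockIncr_le (hB : HasConvexityModulus B p K) (hp : 2 ≤ p)
    (hK : 0 < K) {f : ℤ → B} (hf : lpSum p f ≠ ∞) {n j b : ℕ} (hj : j ≤ n) (hb : b < 2 ^ j) :
    ∑' x, blockIncr p f n j b x ≤
      ((2 : ℝ≥0∞) ^ j)⁻¹ ^ p * (2 ^ p * (((j + 1 : ℕ) : ℝ≥0∞) ^ (p - 1) * ∑ s ∈ range (j + 1),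
        2 * (ENNReal.ofReal (2 * convexityConst p K))⁻¹ * energyDrop p f (n - j + s))) := by
  have hp0 : 0 ≤ p := by linarith
  set i := n - j with hi
  set β := 2 ^ j + b with hβ
  have hn : (2 : ℕ) ^ n = 2 ^ j * 2 ^ i := by rw [← pow_add]; congr 1; omega
  have ha : 2 ^ n + b * 2 ^ i = β * 2 ^ i := by rw [hn, hβ, add_mul]
  have ha' : 2 ^ n + (b + 1) * 2 ^ i = β * 2 ^ i + 2 ^ i := by rw [hn, hβ]; ring
  refine le_trans ?_ (mul_le_mul_right (hB.lpSum_next_sub_le hp hK hf i (j + 1) (β := β)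
    (by positivity) (by rw [pow_succ]; omega)) _)
  rw [lpSum, ← ENNReal.tsum_mul_left]
  refine ENNReal.tsum_le_tsum fun x => ?_
  rw [blockIncr, ← hi, ha, ha', shiftAvg_add_sub (by positivity) (by positivity),
    ← ENNReal.mul_rpow_of_nonneg _ _ hp0, enorm_smul]
  refine ENNReal.rpow_le_rpow (mul_le_mul_left ?_ _) hp0
  have hratio : ((2 ^ i : ℕ) : ℝ) / ((β * 2 ^ i : ℕ) + (2 ^ i : ℕ)) ≤ ((2 : ℝ) ^ j)⁻¹ := by
    rw [div_le_iff₀ (by positivity), inv_mul_eq_div, le_div_iff₀ (by positivity), hβ]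
    push_cast
    have : (0 : ℝ) ≤ b * 2 ^ i + 2 ^ i := by positivity
    linarith
  rw [Real.enorm_of_nonneg (by positivity)]
  refine (ENNReal.ofReal_le_ofReal hratio).trans_eq ?_
  rw [ENNReal.ofReal_inv_of_pos (by positivity), ENNReal.ofReal_pow (by norm_num)]
  simp

/-- The contribution of relative scale `j` to the block variation bound. -/
noncomputable def blockCoeff (p K : ℝ) (j : ℕ) : ℝ≥0∞ :=
  scaleWeight p j * (2 ^ j * (((2 : ℝ≥0∞) ^ j)⁻¹ ^ p * (2 ^ p * (((j + 1 : ℕ) : ℝ≥0∞) ^ (p - 1) *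
    (2 * (ENNReal.ofReal (2 * convexityConst p K))⁻¹)))))

lemma HasConvexityModulus.tsum_blockTotal_le (hB : HasConvexityModulus B p K) (hp : 2 ≤ p)
    (hK : 0 < K) {f : ℤ → B} (hf : lpSum p f ≠ ∞) (n : ℕ) :
    ∑' x, blockTotal p f n x ≤ ∑ j ∈ range (n + 1), blockCoeff p K j *
      ∑ s ∈ range (j + 1), energyDrop p f (n - j + s) := by
  unfold blockTotal
  rw [Summable.tsum_finsetSum fun _ _ => ENNReal.summable]
  refine Finset.sum_le_sum fun j hj => ?_
  rw [ENNReal.tsum_mul_left, Summable.tsum_finsetSum fun _ _ => ENNReal.summable]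
  have hjn : j ≤ n := by rw [Finset.mem_range] at hj; omega
  refine (mul_le_mul_right (Finset.sum_le_sum fun b hb =>
    hB.tsum_blockIncr_le hp hK hf hjn (Finset.mem_range.mp hb)) _).trans_eq ?_
  rw [Finset.sum_const, card_range, nsmul_eq_mul, ← Finset.mul_sum, blockCoeff]
  push_cast
  ring

lemma HasConvexityModulus.tsum_tsum_blockTotal_le (hB : HasConvexityModulus B p K) (hp : 2 ≤ p)
    (hK : 0 < K) {f : ℤ → B} (hf : lpSum p f ≠ ∞) :
    ∑' n, ∑' x, blockTotal p f n x ≤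
      (∑' j, blockCoeff p K j * ((j + 1 : ℕ) : ℝ≥0∞)) * ∑' l, energyDrop p f l := by
  set Q := ∑' l, energyDrop p f l
  have hrange : ∀ n (g : ℕ → ℝ≥0∞), ∑ j ∈ range (n + 1), g j = ∑' j, if j ≤ n then g j else 0 := by
    intro n g
    rw [tsum_eq_sum (s := range (n + 1)) fun j hj => if_neg (by simpa using hj)]
    exact Finset.sum_congr rfl fun j hj => (if_pos (by simpa [Nat.lt_succ_iff] using hj)).symm
  calc _ ≤ ∑' n, ∑' j, if j ≤ n then blockCoeff p K j *
          ∑ s ∈ range (j + 1), energyDrop p f (n - j + s) else 0 :=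
        ENNReal.tsum_le_tsum fun n => (hB.tsum_blockTotal_le hp hK hf n).trans_eq (hrange n _)
    _ = ∑' j, ∑' n, if j ≤ n then blockCoeff p K j *
          ∑ s ∈ range (j + 1), energyDrop p f (n - j + s) else 0 := ENNReal.tsum_comm
    _ ≤ ∑' j, blockCoeff p K j * ((j + 1 : ℕ) : ℝ≥0∞) * Q := by
        refine ENNReal.tsum_le_tsum fun j => ?_
        rw [← ENNReal.summable.sum_add_tsum_nat_add' (k := j),
          Finset.sum_eq_zero fun n hn => if_neg (by simpa using hn), zero_add]
        simp only [Nat.le_add_left, if_true, Nat.add_sub_cancel]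
        rw [ENNReal.tsum_mul_left, Summable.tsum_finsetSum fun _ _ => ENNReal.summable, mul_assoc]
        gcongr
        calc _ ≤ ∑ s ∈ range (j + 1), Q := Finset.sum_le_sum fun s _ =>
              ENNReal.tsum_comp_le_tsum_of_injective (add_left_injective s) _
          _ = _ := by rw [Finset.sum_const, card_range, nsmul_eq_mul]
    _ = _ := ENNReal.tsum_mul_right

lemma tsum_blockCoeff_ne_top (hp : 2 ≤ p) (hK : 0 < K) :
    ∑' j, blockCoeff p K j * ((j + 1 : ℕ) : ℝ≥0∞) ≠ ∞ := by
  obtain ⟨C, hC0, hC⟩ : ∃ C : ℝ, 0 ≤ C ∧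
      ∀ j : ℕ, ((j : ℝ) + 2) ^ 4 * (1 / 2) ^ j ≤ C * (3 / 4) ^ j := by
    have hO := (isLittleO_pow_const_mul_const_pow_const_pow_of_norm_lt (R := ℝ) 4
      (r₁ := 1 / 2) (r₂ := 3 / 4) (by norm_num)).isBigO
    obtain ⟨C, hC0, hC⟩ := Asymptotics.bound_of_isBigO_nat_atTop hO
    refine ⟨4 * (3 / 4) ^ 2 * C, by positivity, fun j => ?_⟩
    have := @hC (j + 2) (by positivity)
    rw [Real.norm_of_nonneg (by positivity), Real.norm_of_nonneg (by positivity)] at this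
    push_cast at this
    calc ((j : ℝ) + 2) ^ 4 * (1 / 2) ^ j = 4 * (((j : ℝ) + 2) ^ 4 * (1 / 2) ^ (j + 2)) := by ring
      _ ≤ 4 * (C * (3 / 4) ^ (j + 2)) := by gcongr
      _ = _ := by ring
  have hq : 1 ≤ p - 1 := by linarith
  have hq0 : 0 ≤ p - 1 := by linarith
  set M : ℝ≥0∞ := 2 ^ p * (2 * (ENNReal.ofReal (2 * convexityConst p K))⁻¹) with hM
  have hMtop : M ≠ ∞ := by
    have : 0 < convexityConst p K := convexityConst_pos hK
    refine ENNReal.mul_ne_top (by simp) (ENNReal.mul_ne_top (by simp) ?_)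
    simpa using this
  set r : ℝ≥0∞ := ENNReal.ofReal (3 / 4) with hr
  have hr1 : r < 1 := by
    rw [hr, ← ENNReal.ofReal_one]
    exact (ENNReal.ofReal_lt_ofReal_iff one_pos).mpr (by norm_num)
  have hterm : ∀ j : ℕ, blockCoeff p K j * ((j + 1 : ℕ) : ℝ≥0∞) ≤
      M * ENNReal.ofReal C ^ (p - 1) * r ^ j := fun j => by
    set a : ℝ≥0∞ := ((j + 2 : ℕ) : ℝ≥0∞) with ha
    set h : ℝ≥0∞ := ((2 : ℝ≥0∞) ^ j)⁻¹ with hh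
    have ha1 : ((j + 1 : ℕ) : ℝ≥0∞) ≤ a := by rw [ha]; exact_mod_cast Nat.le_succ _
    have haq : ((j + 1 : ℕ) : ℝ≥0∞) ≤ a ^ (p - 1) := by
      refine ha1.trans ?_
      refine (ENNReal.rpow_one a).symm.trans_le (ENNReal.rpow_le_rpow_of_exponent_le ?_ hq)
      rw [ha]
      exact_mod_cast Nat.le_add_left 1 (j + 1)
    have hW : scaleWeight p j ≤ a ^ (p - 1) * a ^ (p - 1) := by
      rw [scaleWeight, Nat.cast_mul, ENNReal.mul_rpow_of_nonneg _ _ hq0]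
      gcongr
    have h2 : (2 : ℝ≥0∞) ^ j * h ^ p = h ^ (p - 1) := by
      have hsplit : h ^ p = h ^ (p - 1) * h := by
        conv_rhs => rw [← ENNReal.rpow_one h, ← ENNReal.rpow_mul, one_mul]
        rw [← ENNReal.rpow_add_of_nonneg _ _ hq0 zero_le_one, sub_add_cancel]
      rw [hsplit, mul_comm, mul_assoc, ENNReal.inv_mul_cancel (by simp) (by simp), mul_one]
    have hah : a ^ 4 * h ≤ ENNReal.ofReal C * r ^ j := by
      rw [hr, ← ENNReal.ofReal_pow (by norm_num), ← ENNReal.ofReal_mul hC0]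
      refine le_trans (le_of_eq ?_) (ENNReal.ofReal_le_ofReal (hC j))
      rw [ENNReal.ofReal_mul (by positivity), ENNReal.ofReal_pow (by positivity),
        ENNReal.ofReal_pow (by positivity), hh, ENNReal.inv_pow, one_div,
        ENNReal.ofReal_inv_of_pos two_pos, ha]
      congr 2
      · rw [← ENNReal.ofReal_natCast]
        push_cast
        rfl
      · simp
    calc blockCoeff p K j * ((j + 1 : ℕ) : ℝ≥0∞)
        = M * (scaleWeight p j * (2 ^ j * h ^ p) * ((j + 1 : ℕ) : ℝ≥0∞) ^ (p - 1) *
            ((j + 1 : ℕ) : ℝ≥0∞)) := by rw [blockCoeff]; ring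
      _ ≤ M * (a ^ (p - 1) * a ^ (p - 1) * h ^ (p - 1) * a ^ (p - 1) * a ^ (p - 1)) := by
          rw [h2]; gcongr
      _ = M * (a ^ 4 * h) ^ (p - 1) := by
          rw [ENNReal.mul_rpow_of_nonneg _ _ hq0, ← ENNReal.rpow_natCast, ← ENNReal.rpow_mul,
            mul_comm ((4 : ℕ) : ℝ), ENNReal.rpow_mul, ENNReal.rpow_natCast]
          ring
      _ ≤ M * (ENNReal.ofReal C * r ^ j) ^ (p - 1) := by gcongr
      _ ≤ M * (ENNReal.ofReal C ^ (p - 1) * r ^ j) := by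
          rw [ENNReal.mul_rpow_of_nonneg _ _ hq0]
          gcongr
          refine (ENNReal.rpow_le_rpow_of_exponent_ge ?_ hq).trans_eq (ENNReal.rpow_one _)
          exact pow_le_one₀ zero_le hr1.le
      _ = _ := by ring
  refine ne_top_of_le_ne_top ?_ (ENNReal.tsum_le_tsum hterm)
  rw [ENNReal.tsum_mul_left, ENNReal.tsum_geometric]
  refine ENNReal.mul_ne_top (ENNReal.mul_ne_top hMtop
    (ENNReal.rpow_ne_top_of_nonneg hq0 ENNReal.ofReal_ne_top)) ?_
  rw [Ne, ENNReal.inv_eq_top, tsub_eq_zero_iff_le, not_le]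
  exact hr1

end BlockBounds

section Assembly

variable {B : Type*} [NormedAddCommGroup B] [NormedSpace ℝ B] {p K : ℝ}

/-- The `p`-th power of the oscillation of the averages over lengths in `[s, t]`. -/
noncomputable def avgOsc (p : ℝ) (f : ℤ → B) (s t : ℕ) (x : ℤ) : ℝ≥0∞ :=
  ⨆ u ∈ Set.Icc s t, ⨆ v ∈ Set.Icc s t, ‖shiftAvg u f x - shiftAvg v f x‖ₑ ^ p

lemma avgOsc_le_blockVar (hp : 1 ≤ p) (f : ℤ → B) {n s t : ℕ} (hs : 2 ^ n ≤ s)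
    (ht : t ≤ 2 ^ (n + 1)) (x : ℤ) : avgOsc p f s t x ≤ 2 ^ p * blockVar p f n s t x := by
  refine iSup₂_le fun u hu => iSup₂_le fun v hv => ?_
  rcases le_total u v with huv | hvu
  · rw [← enorm_neg, neg_sub]
    exact enorm_shiftAvg_sub_le_blockVar hp f x (hs.trans hu.1) hu.1 huv hv.2 (hv.2.trans ht)
  · exact enorm_shiftAvg_sub_le_blockVar hp f x (hs.trans hv.1) hv.1 hvu hu.2 (hu.2.trans ht)

lemma enorm_shiftAvg_sub_log_le (hp : 1 ≤ p) (f : ℤ → B) {u : ℕ} (hu : u ≠ 0) (x : ℤ) :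
    ‖shiftAvg u f x - shiftAvg (2 ^ Nat.log 2 u) f x‖ₑ ^ p ≤
      2 ^ p * blockTotal p f (Nat.log 2 u) x := by
  have hle : 2 ^ Nat.log 2 u ≤ u := Nat.pow_log_le_self 2 hu
  refine (enorm_shiftAvg_sub_le_blockVar hp f x (s := 2 ^ Nat.log 2 u) (t := u) le_rfl le_rfl hle
    le_rfl (Nat.lt_pow_succ_log_self one_lt_two u).le).trans ?_
  gcongr
  exact blockVar_le_blockTotal f _ _ _ x

lemma avgOsc_le_dyadicOsc_add (hp : 1 ≤ p) (f : ℤ → B) {s t : ℕ} (hs : 0 < s) (x : ℤ) :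
    avgOsc p f s t x ≤ 3 ^ (p - 1) * (dyadicOsc p f (Nat.log 2 s) (Nat.log 2 t) x +
      2 * (2 ^ p * ∑ n ∈ Finset.Icc (Nat.log 2 s) (Nat.log 2 t), blockTotal p f n x)) := by
  have hp0 : 0 ≤ p := by linarith
  set S := 2 ^ p * ∑ n ∈ Finset.Icc (Nat.log 2 s) (Nat.log 2 t), blockTotal p f n x with hS
  have hlog : ∀ u ∈ Set.Icc s t, Nat.log 2 u ∈ Set.Icc (Nat.log 2 s) (Nat.log 2 t) :=
    fun u hu => ⟨Nat.log_mono_right hu.1, Nat.log_mono_right hu.2⟩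
  have hend : ∀ u ∈ Set.Icc s t,
      ‖shiftAvg u f x - shiftAvg (2 ^ Nat.log 2 u) f x‖ₑ ^ p ≤ S := fun u hu => by
    refine (enorm_shiftAvg_sub_log_le hp f (hs.trans_le hu.1).ne' x).trans ?_
    rw [hS]
    gcongr
    exact Finset.single_le_sum (f := fun n => blockTotal p f n x) (fun _ _ => zero_le)
      (Finset.mem_Icc.mpr (hlog u hu))
  refine iSup₂_le fun u hu => iSup₂_le fun v hv => ?_
  set a := shiftAvg u f x - shiftAvg (2 ^ Nat.log 2 u) f x
  set b := shiftAvg (2 ^ Nat.log 2 u) f x - shiftAvg (2 ^ Nat.log 2 v) f x with hb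
  set c := shiftAvg v f x - shiftAvg (2 ^ Nat.log 2 v) f x
  have htri : ‖shiftAvg u f x - shiftAvg v f x‖ₑ ≤ ∑ i, ![‖a‖ₑ, ‖b‖ₑ, ‖c‖ₑ] i := by
    have : shiftAvg u f x - shiftAvg v f x = a + b - c := by simp only [a, b, c]; abel
    rw [this, Fin.sum_univ_three]
    exact enorm_sub_le.trans (add_le_add_left (enorm_add_le a b) _)
  have hbosc : ‖b‖ₑ ^ p ≤ dyadicOsc p f (Nat.log 2 s) (Nat.log 2 t) x :=
    le_iSup₂_of_le (Nat.log 2 u) (hlog u hu) (le_iSup₂_of_le (Nat.log 2 v) (hlog v hv) le_rfl)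
  calc _ ≤ (∑ i, ![‖a‖ₑ, ‖b‖ₑ, ‖c‖ₑ] i) ^ p := ENNReal.rpow_le_rpow htri hp0
    _ ≤ 3 ^ (p - 1) * (‖a‖ₑ ^ p + ‖b‖ₑ ^ p + ‖c‖ₑ ^ p) := by
        have := ENNReal.rpow_sum_le_const_mul_sum_rpow univ ![‖a‖ₑ, ‖b‖ₑ, ‖c‖ₑ] hp
        simpa [Fin.sum_univ_three] using this
    _ ≤ 3 ^ (p - 1) * (S + dyadicOsc p f (Nat.log 2 s) (Nat.log 2 t) x + S) := by
        gcongr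
        · exact hend u hu
        · exact hend v hv
    _ = _ := by ring

lemma tsum_ite_sum_Icc_le {N : ℕ → ℕ} (hN : Monotone N) (w : ℕ → ℝ≥0∞) :
    ∑' k, (if N k < N (k + 1) then ∑ n ∈ Finset.Icc (N k) (N (k + 1)), w n else 0) ≤
      2 * ∑' n, w n := by
  have hsplit : ∀ k, (if N k < N (k + 1) then ∑ n ∈ Finset.Icc (N k) (N (k + 1)), w n else 0) ≤
      ∑' n, ((if N k ≤ n ∧ n < N (k + 1) then w n else 0) +
        if N k < n ∧ n = N (k + 1) then w n else 0) := fun k => by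
    split_ifs with h
    · refine le_trans (Finset.sum_le_sum fun n hn => ?_) (ENNReal.sum_le_tsum _)
      rw [Finset.mem_Icc] at hn
      rcases hn.2.lt_or_eq with hlt | heq
      · rw [if_pos ⟨hn.1, hlt⟩]
        exact le_self_add
      · rw [if_pos (c := N k < n ∧ n = N (k + 1)) ⟨heq ▸ h, heq⟩]
        exact le_add_self
    · exact zero_le
  calc _ ≤ ∑' k, ∑' n, ((if N k ≤ n ∧ n < N (k + 1) then w n else 0) +
        if N k < n ∧ n = N (k + 1) then w n else 0) := ENNReal.tsum_le_tsum hsplit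
    _ = ∑' n, ((∑' k, if N k ≤ n ∧ n < N (k + 1) then w n else 0) +
        ∑' k, if N k < n ∧ n = N (k + 1) then w n else 0) := by
        rw [ENNReal.tsum_comm]
        simp only [ENNReal.tsum_add]
    _ ≤ ∑' n, (w n + w n) := by
        refine ENNReal.tsum_le_tsum fun n => add_le_add
          (tsum_ite_le_of_subsingleton _ fun k l hk hl => ?_)
          (tsum_ite_le_of_subsingleton _ fun k l hk hl => ?_)
        all_goals
          by_contra hne
          rcases Nat.lt_or_gt_of_ne hne with h | h <;> have := hN (Nat.add_one_le_of_lt h) <;> omega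
    _ = 2 * ∑' n, w n := by rw [← ENNReal.tsum_mul_left]; simp only [two_mul]

lemma avgOsc_le_blockVar_add_long (hp : 1 ≤ p) (f : ℤ → B) {s t : ℕ} (hs : 0 < s) (hst : s ≤ t)
    (x : ℤ) : avgOsc p f s t x ≤ 2 ^ p * ∑' n, blockVar p f n s t x +
      if Nat.log 2 s < Nat.log 2 t then
        3 ^ (p - 1) * (dyadicOsc p f (Nat.log 2 s) (Nat.log 2 t) x +
          2 * (2 ^ p * ∑ n ∈ Finset.Icc (Nat.log 2 s) (Nat.log 2 t), blockTotal p f n x))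
      else 0 := by
  split_ifs with h
  · exact (avgOsc_le_dyadicOsc_add hp f hs x).trans le_add_self
  · rw [add_zero]
    have heq : Nat.log 2 t = Nat.log 2 s := le_antisymm (not_lt.mp h) (Nat.log_mono_right hst)
    refine (avgOsc_le_blockVar hp f (Nat.pow_log_le_self 2 hs.ne')
      (heq ▸ (Nat.lt_pow_succ_log_self one_lt_two t).le) x).trans ?_
    gcongr
    exact ENNReal.le_tsum _

/-- The constant in the jump estimate, as an extended nonnegative real. -/
noncomputable def oscConst (p K : ℝ) : ℝ≥0∞ :=
  2 ^ p * (∑' j, blockCoeff p K j * ((j + 1 : ℕ) : ℝ≥0∞)) +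
    2 * (3 ^ (p - 1) * (2 ^ p * 8 * (ENNReal.ofReal (2 * convexityConst p K))⁻¹ +
      2 * (2 ^ p * (∑' j, blockCoeff p K j * ((j + 1 : ℕ) : ℝ≥0∞)))))

lemma oscConst_ne_top (hp : 2 ≤ p) (hK : 0 < K) : oscConst p K ≠ ∞ := by
  have hS := tsum_blockCoeff_ne_top hp hK
  have h2 : (2 : ℝ≥0∞) ^ p ≠ ∞ := ENNReal.rpow_ne_top_of_nonneg (by linarith) (by simp)
  have h3 : (3 : ℝ≥0∞) ^ (p - 1) ≠ ∞ := ENNReal.rpow_ne_top_of_nonneg (by linarith) (by simp)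
  have hc : (ENNReal.ofReal (2 * convexityConst p K))⁻¹ ≠ ∞ := by
    simpa using convexityConst_pos hK
  exact ENNReal.add_ne_top.mpr ⟨ENNReal.mul_ne_top h2 hS, ENNReal.mul_ne_top (by simp)
    (ENNReal.mul_ne_top h3 (ENNReal.add_ne_top.mpr
      ⟨ENNReal.mul_ne_top (ENNReal.mul_ne_top h2 (by simp)) hc,
        ENNReal.mul_ne_top (by simp) (ENNReal.mul_ne_top h2 hS)⟩))⟩

lemma HasConvexityModulus.tsum_tsum_avgOsc_le (hB : HasConvexityModulus B p K) (hp : 2 ≤ p)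
    (hK : 0 < K) {f : ℤ → B} (hf : lpSum p f ≠ ∞) {t : ℕ → ℕ} (ht : StrictMono t)
    (ht0 : ∀ k, 0 < t k) :
    ∑' x, ∑' k, avgOsc p f (t k) (t (k + 1)) x ≤ oscConst p K * lpSum p f := by
  set N : ℕ → ℕ := fun k => Nat.log 2 (t k) with hNdef
  have hN : Monotone N := fun k l h => Nat.log_mono_right (ht.monotone h)
  set A : ℝ≥0∞ := 2 ^ p * 8 * (ENNReal.ofReal (2 * convexityConst p K))⁻¹ with hA
  set T : ℕ → ℝ≥0∞ := fun n => ∑' x, blockTotal p f n x with hT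
  set w : ℕ → ℝ≥0∞ := fun n => 3 ^ (p - 1) * (A * energyDrop p f n + 2 * (2 ^ p * T n)) with hw
  set S := ∑' j, blockCoeff p K j * ((j + 1 : ℕ) : ℝ≥0∞) with hS
  have hE := hB.sum_energyDrop_le hp hK f
  have hTsum : ∑' n, T n ≤ S * lpSum p f :=
    (hB.tsum_tsum_blockTotal_le hp hK hf).trans (mul_le_mul_right hE _)
  have hlong : ∀ k, N k < N (k + 1) →
      ∑' x, 3 ^ (p - 1) * (dyadicOsc p f (N k) (N (k + 1)) x +
        2 * (2 ^ p * ∑ n ∈ Finset.Icc (N k) (N (k + 1)), blockTotal p f n x)) ≤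
      ∑ n ∈ Finset.Icc (N k) (N (k + 1)), w n := fun k hk => by
    rw [ENNReal.tsum_mul_left, ENNReal.tsum_add, ENNReal.tsum_mul_left, ENNReal.tsum_mul_left,
      Summable.tsum_finsetSum fun _ _ => ENNReal.summable, hw, ← Finset.mul_sum,
      Finset.sum_add_distrib, ← Finset.mul_sum, ← Finset.mul_sum, ← Finset.mul_sum]
    gcongr
    obtain ⟨d, hd⟩ := Nat.exists_eq_add_of_le hk.le
    rw [hd]
    refine (hB.tsum_dyadicOsc_le hp hK hf (N k) d).trans_eq ?_
    rw [← Finset.Ico_add_one_right_eq_Icc, Finset.sum_Ico_eq_sum_range]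
    congr 3
    omega
  have hshort : ∑' x, ∑' k, ∑' n, blockVar p f n (t k) (t (k + 1)) x ≤ ∑' n, T n := by
    calc _ ≤ ∑' x, ∑' n, blockTotal p f n x := by
          refine ENNReal.tsum_le_tsum fun x => ?_
          rw [ENNReal.tsum_comm]
          exact ENNReal.tsum_le_tsum fun n => tsum_blockVar_le f n ht x
      _ = _ := ENNReal.tsum_comm
  calc _ ≤ ∑' x, ∑' k, (2 ^ p * ∑' n, blockVar p f n (t k) (t (k + 1)) x +
        if N k < N (k + 1) then 3 ^ (p - 1) * (dyadicOsc p f (N k) (N (k + 1)) x +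
          2 * (2 ^ p * ∑ n ∈ Finset.Icc (N k) (N (k + 1)), blockTotal p f n x)) else 0) :=
        ENNReal.tsum_le_tsum fun x => ENNReal.tsum_le_tsum fun k =>
          avgOsc_le_blockVar_add_long (by linarith) f (ht0 k) (ht.monotone k.le_succ) x
    _ = 2 ^ p * ∑' x, ∑' k, ∑' n, blockVar p f n (t k) (t (k + 1)) x +
        ∑' k, ∑' x, if N k < N (k + 1) then 3 ^ (p - 1) * (dyadicOsc p f (N k) (N (k + 1)) x +
          2 * (2 ^ p * ∑ n ∈ Finset.Icc (N k) (N (k + 1)), blockTotal p f n x)) else 0 := by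
        simp only [ENNReal.tsum_add, ENNReal.tsum_mul_left]
        congr 1
        exact ENNReal.tsum_comm
    _ ≤ 2 ^ p * ∑' n, T n +
        ∑' k, if N k < N (k + 1) then ∑ n ∈ Finset.Icc (N k) (N (k + 1)), w n else 0 := by
        refine add_le_add (mul_le_mul_right hshort _) (ENNReal.tsum_le_tsum fun k => ?_)
        split_ifs with hk
        · exact hlong k hk
        · simp
    _ ≤ 2 ^ p * ∑' n, T n + 2 * ∑' n, w n := by
        gcongr
        exact tsum_ite_sum_Icc_le hN w
    _ = 2 ^ p * ∑' n, T n + 2 * (3 ^ (p - 1) * (A * ∑' n, energyDrop p f n +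
          2 * (2 ^ p * ∑' n, T n))) := by
        simp only [hw, ENNReal.tsum_mul_left, ENNReal.tsum_add]
    _ ≤ 2 ^ p * (S * lpSum p f) + 2 * (3 ^ (p - 1) * (A * lpSum p f +
          2 * (2 ^ p * (S * lpSum p f)))) := by
        gcongr
    _ = _ := by
        rw [oscConst]
        ring

end Assembly

/-- For `p ≥ 2`, `K > 0` there is `C > 0` depending only on `p` and `K` such that for every real
Banach space `B` with modulus of uniform convexity `η(ε) = K ε^p`, every `f ∈ ℓ^p(B)` and every
strictly increasing sequence `(t k)` of positive integers,
`∑_{x ∈ ℤ} ∑ₖ sup_{u,v ∈ [t k, t (k+1)]} ‖(A_u f)(x) − (A_v f)(x)‖^p ≤ C^p ‖f‖_{ℓ^p(B)}^p`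
(in `ℝ≥0∞`, with the suprema over integers `u, v` in `[t k, t (k+1)]`). -/
theorem stmt9 (p K : ℝ) (hp : 2 ≤ p) (hK : 0 < K) :
    ∃ C : ℝ, 0 < C ∧
      ∀ (B : Type*) [NormedAddCommGroup B] [NormedSpace ℝ B] [CompleteSpace B],
        (∀ ε ∈ Set.Ioc (0 : ℝ) 2, ∀ x y : B, ‖x‖ ≤ 1 → ‖y‖ ≤ 1 → ε ≤ ‖x - y‖ →
          ‖(1 / 2 : ℝ) • (x + y)‖ ≤ 1 - K * ε ^ p) →
        ∀ f : ℤ → B, Memℓp f (ENNReal.ofReal p) →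
        ∀ t : ℕ → ℕ, StrictMono t → (∀ k, 0 < t k) →
          ∑' x : ℤ, ∑' k : ℕ,
              ⨆ u ∈ Set.Icc (t k) (t (k + 1)), ⨆ v ∈ Set.Icc (t k) (t (k + 1)),
                (‖shiftAvg u f x - shiftAvg v f x‖₊ : ℝ≥0∞) ^ p
            ≤ ENNReal.ofReal C ^ p * ∑' x : ℤ, (‖f x‖₊ : ℝ≥0∞) ^ p := by
  refine ⟨((oscConst p K).toReal + 1) ^ (1 / p), by positivity, ?_⟩
  intro B _ _ _ hB f _ t ht ht0
  have hC : oscConst p K ≤ ENNReal.ofReal (((oscConst p K).toReal + 1) ^ (1 / p)) ^ p := by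
    rw [ENNReal.ofReal_rpow_of_nonneg (by positivity) (by linarith),
      ← Real.rpow_mul (by positivity), one_div_mul_cancel (by linarith), Real.rpow_one]
    refine (ENNReal.ofReal_toReal (oscConst_ne_top hp hK)).symm.trans_le ?_
    exact ENNReal.ofReal_le_ofReal (by linarith)
  change ∑' x, ∑' k, avgOsc p f (t k) (t (k + 1)) x ≤ _ * lpSum p f
  by_cases hf : lpSum p f = ∞
  · rw [hf, ENNReal.mul_top]
    · exact le_top
    · exact (ENNReal.rpow_pos (ENNReal.ofReal_pos.mpr (by positivity)) ENNReal.ofReal_ne_top).ne'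
  · refine (HasConvexityModulus.tsum_tsum_avgOsc_le hB hp hK hf ht ht0).trans ?_
    gcongr
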